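/- arXiv:cs/0611029 — 2 statements merged into one kernel-verified Lean document; each statement's English description precedes it below -/
import Mathlib

section
/- Let ψ be a PLTL formula and let B^ψ be the symbolic Büchi automaton obtained by virtually unrolling the tableau-style automaton up to past operator depth δ(ψ). Then L(B^ψ) = {α ∈ (2^AP)^ω | α ⊨ ψ} and B^ψ is tight, i.e. for every α = βγ^ω ∈ L(B^ψ) there is an accepting run ρ = στ^ω with |σ| = |β| and |τ| = |γ|. -/
namespace BMC

/-- PLTL formulas in positive normal form: literals `p`, `¬p`, conjunction,
disjunction, next `X`, until `U`, release `R`, previous `Y`, weak previous `Z`,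
since `S` and trigger `T`. -/
inductive PLTL (AP : Type) : Type
  | atom  : AP → PLTL AP
  | natom : AP → PLTL AP
  | conj  : PLTL AP → PLTL AP → PLTL AP
  | disj  : PLTL AP → PLTL AP → PLTL AP
  | next  : PLTL AP → PLTL AP
  | untl  : PLTL AP → PLTL AP → PLTL AP
  | rels  : PLTL AP → PLTL AP → PLTL AP
  | prev  : PLTL AP → PLTL AP
  | wprev : PLTL AP → PLTL AP
  | since : PLTL AP → PLTL AP → PLTL AP
  | trig  : PLTL AP → PLTL AP → PLTL AP

variable {AP S : Type}

/-- Standard PLTL semantics `π^i ⊨ φ` on an infinite sequence of states `π`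
with labelling `L`. -/
def PLTL.sat (L : S → Set AP) (π : ℕ → S) : PLTL AP → ℕ → Prop
  | .atom p, i => p ∈ L (π i)
  | .natom p, i => p ∉ L (π i)
  | .conj f g, i => PLTL.sat L π f i ∧ PLTL.sat L π g i
  | .disj f g, i => PLTL.sat L π f i ∨ PLTL.sat L π g i
  | .next f, i => PLTL.sat L π f (i + 1)
  | .untl f g, i => ∃ j, i ≤ j ∧ PLTL.sat L π g j ∧ ∀ n, i ≤ n → n < j → PLTL.sat L π f n
  | .rels f g, i => ∀ j, i ≤ j → (PLTL.sat L π g j ∨ ∃ n, i ≤ n ∧ n < j ∧ PLTL.sat L π f n)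
  | .prev f, i => 0 < i ∧ PLTL.sat L π f (i - 1)
  | .wprev f, i => i = 0 ∨ PLTL.sat L π f (i - 1)
  | .since f g, i => ∃ j, j ≤ i ∧ PLTL.sat L π g j ∧ ∀ n, j < n → n ≤ i → PLTL.sat L π f n
  | .trig f g, i => ∀ j, j ≤ i → (PLTL.sat L π g j ∨ ∃ n, j < n ∧ n ≤ i ∧ PLTL.sat L π f n)

/-- The no-loop bounded semantics `π^i ⊨_nl φ` with bound `k`: future operators
are restricted to positions `≤ k`. -/
def PLTL.satNL (L : S → Set AP) (π : ℕ → S) (k : ℕ) : PLTL AP → ℕ → Prop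
  | .atom p, i => p ∈ L (π i)
  | .natom p, i => p ∉ L (π i)
  | .conj f g, i => PLTL.satNL L π k f i ∧ PLTL.satNL L π k g i
  | .disj f g, i => PLTL.satNL L π k f i ∨ PLTL.satNL L π k g i
  | .next f, i => i < k ∧ PLTL.satNL L π k f (i + 1)
  | .untl f g, i => ∃ j, i ≤ j ∧ j ≤ k ∧ PLTL.satNL L π k g j ∧
      ∀ n, i ≤ n → n < j → PLTL.satNL L π k f n
  | .rels f g, i => ∃ j, i ≤ j ∧ j ≤ k ∧ PLTL.satNL L π k f j ∧
      ∀ n, i ≤ n → n ≤ j → PLTL.satNL L π k g n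
  | .prev f, i => 0 < i ∧ PLTL.satNL L π k f (i - 1)
  | .wprev f, i => i = 0 ∨ PLTL.satNL L π k f (i - 1)
  | .since f g, i => ∃ j, j ≤ i ∧ PLTL.satNL L π k g j ∧
      ∀ n, j < n → n ≤ i → PLTL.satNL L π k f n
  | .trig f g, i => ∀ j, j ≤ i → (PLTL.satNL L π k g j ∨
      ∃ n, j < n ∧ n ≤ i ∧ PLTL.satNL L π k f n)

/-- `π` is a (k,l)-loop: `0 < l ≤ k`, `π (l-1) = π k`, and from position `l`
onwards `π` is periodic with period `p = k + 1 - l`. -/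
def IsKLoop (π : ℕ → S) (k l : ℕ) : Prop :=
  0 < l ∧ l ≤ k ∧ π (l - 1) = π k ∧ ∀ i, l ≤ i → π (i + (k + 1 - l)) = π i

/-- The bounded semantics `π ⊨_k φ`. -/
def PLTL.bsat (L : S → Set AP) (π : ℕ → S) (k : ℕ) (φ : PLTL AP) : Prop :=
  (∃ l, IsKLoop π k l ∧ PLTL.sat L π φ 0) ∨ PLTL.satNL L π k φ 0

/-- The past operator depth `δ`. -/
def PLTL.delta : PLTL AP → ℕ
  | .atom _ => 0
  | .natom _ => 0
  | .conj f g => max f.delta g.delta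
  | .disj f g => max f.delta g.delta
  | .next f => f.delta
  | .untl f g => max f.delta g.delta
  | .rels f g => max f.delta g.delta
  | .prev f => f.delta + 1
  | .wprev f => f.delta + 1
  | .since f g => max f.delta g.delta + 1
  | .trig f g => max f.delta g.delta + 1

/-- A Kripke structure over state space `S` and atomic propositions `AP`. -/
structure Kripke (S AP : Type) where
  T : S → S → Prop
  I : S → Prop
  L : S → Set AP

/-- The transition relation is total. -/
def Kripke.Total (M : Kripke S AP) : Prop := ∀ s, ∃ s', M.T s s'

/-- An initialised infinite path of `M`. -/
def Kripke.InitPath (M : Kripke S AP) (π : ℕ → S) : Prop :=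
  M.I (π 0) ∧ ∀ i, M.T (π i) (π (i + 1))

end BMC
namespace BMC

variable {AP : Type}

/-- A state of the symbolic Büchi automaton `B^ψ`: the state variables
`⟦φ⟧^d` for the subformulas `φ` of `ψ` and unrollings `d ≤ δ(φ)`, plus the
oracles `InLoop` and `le`. -/
structure BASt (AP : Type) where
  val : PLTL AP → ℕ → Prop
  inLoop : Prop
  le : Prop

/-- Lookup of `⟦φ⟧^d` in a state, with the convention
`⟦φ⟧^d = ⟦φ⟧^{δ(φ)}` for `d > δ(φ)`. -/
def bv (x : BASt AP) (φ : PLTL AP) (d : ℕ) : Prop := x.val φ (min d φ.delta)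

/-- Componentwise state constraints for Boolean operators (and consistency of
the literals), generated recursively for all subformulas. -/
def baStC (x : BASt AP) : PLTL AP → Prop
  | .atom _ => True
  | .natom p => bv x (.natom p) 0 ↔ ¬ bv x (.atom p) 0
  | .conj f g => baStC x f ∧ baStC x g ∧
      (∀ d, d ≤ (PLTL.conj f g).delta →
        (x.val (.conj f g) d ↔ (bv x f d ∧ bv x g d)))
  | .disj f g => baStC x f ∧ baStC x g ∧
      (∀ d, d ≤ (PLTL.disj f g).delta →
        (x.val (.disj f g) d ↔ (bv x f d ∨ bv x g d)))
  | .next f => baStC x f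
  | .untl f g => baStC x f ∧ baStC x g
  | .rels f g => baStC x f ∧ baStC x g
  | .prev f => baStC x f
  | .wprev f => baStC x f
  | .since f g => baStC x f ∧ baStC x g
  | .trig f g => baStC x f ∧ baStC x g

/-- The state invariant of `B^ψ`: `le ⇒ InLoop` and the Boolean constraints. -/
def baState (ψ : PLTL AP) (x : BASt AP) : Prop :=
  (x.le → x.inLoop) ∧ baStC x ψ

/-- Initialisation of the past operators at unrolling `0`, generated
recursively for all subformulas. -/
def baInitC (x : BASt AP) : PLTL AP → Prop
  | .atom _ => True
  | .natom _ => True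
  | .conj f g => baInitC x f ∧ baInitC x g
  | .disj f g => baInitC x f ∧ baInitC x g
  | .next f => baInitC x f
  | .untl f g => baInitC x f ∧ baInitC x g
  | .rels f g => baInitC x f ∧ baInitC x g
  | .prev f => baInitC x f ∧ ¬ x.val (.prev f) 0
  | .wprev f => baInitC x f ∧ x.val (.wprev f) 0
  | .since f g => baInitC x f ∧ baInitC x g ∧
      (x.val (.since f g) 0 ↔ bv x g 0)
  | .trig f g => baInitC x f ∧ baInitC x g ∧
      (x.val (.trig f g) 0 ↔ bv x g 0)

/-- Initial states of `B^ψ`: the state invariant, the initialisation of the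
past operators, and the initial state constraint `⟦ψ⟧^0`. -/
def baInit (ψ : PLTL AP) (x : BASt AP) : Prop :=
  baState ψ x ∧ baInitC x ψ ∧ bv x ψ 0

/-- The transition constraints of `B^ψ` for the temporal operators, generated
recursively for all subformulas: within a loop iteration and on the stem
(`¬le` and not entering the loop at an unrolling `d > 0`) the one-step
current/next-state characterisations hold at each unrolling, and on
transitions with `le` unrolling `d` is linked to unrolling
`min(d+1, δ(φ))`. -/
def baTrC (x y : BASt AP) : PLTL AP → Prop
  | .atom _ => True
  | .natom _ => True
  | .conj f g => baTrC x y f ∧ baTrC x y g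
  | .disj f g => baTrC x y f ∧ baTrC x y g
  | .next f => baTrC x y f ∧
      (∀ d, d ≤ (PLTL.next f).delta →
        ((¬ x.le ∧ ¬ (¬ x.inLoop ∧ y.inLoop ∧ 0 < d)) →
          (x.val (.next f) d ↔ bv y f d)) ∧
        (x.le → (x.val (.next f) d ↔ bv y f (d + 1))))
  | .untl f g => baTrC x y f ∧ baTrC x y g ∧
      (∀ d, d ≤ (PLTL.untl f g).delta →
        ((¬ x.le ∧ ¬ (¬ x.inLoop ∧ y.inLoop ∧ 0 < d)) →
          (x.val (.untl f g) d ↔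
            (bv x g d ∨ (bv x f d ∧ bv y (.untl f g) d)))) ∧
        (x.le → (x.val (.untl f g) d ↔
            (bv x g d ∨ (bv x f d ∧ bv y (.untl f g) (d + 1))))))
  | .rels f g => baTrC x y f ∧ baTrC x y g ∧
      (∀ d, d ≤ (PLTL.rels f g).delta →
        ((¬ x.le ∧ ¬ (¬ x.inLoop ∧ y.inLoop ∧ 0 < d)) →
          (x.val (.rels f g) d ↔
            (bv x g d ∧ (bv x f d ∨ bv y (.rels f g) d)))) ∧
        (x.le → (x.val (.rels f g) d ↔
            (bv x g d ∧ (bv x f d ∨ bv y (.rels f g) (d + 1))))))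
  | .prev f => baTrC x y f ∧
      (∀ d, d ≤ (PLTL.prev f).delta →
        ((¬ x.le ∧ ¬ (¬ x.inLoop ∧ y.inLoop ∧ 0 < d)) →
          (y.val (.prev f) d ↔ bv x f d)) ∧
        (x.le → (bv y (.prev f) (d + 1) ↔ bv x f d)))
  | .wprev f => baTrC x y f ∧
      (∀ d, d ≤ (PLTL.wprev f).delta →
        ((¬ x.le ∧ ¬ (¬ x.inLoop ∧ y.inLoop ∧ 0 < d)) →
          (y.val (.wprev f) d ↔ bv x f d)) ∧
        (x.le → (bv y (.wprev f) (d + 1) ↔ bv x f d)))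
  | .since f g => baTrC x y f ∧ baTrC x y g ∧
      (∀ d, d ≤ (PLTL.since f g).delta →
        ((¬ x.le ∧ ¬ (¬ x.inLoop ∧ y.inLoop ∧ 0 < d)) →
          (y.val (.since f g) d ↔
            (bv y g d ∨ (bv y f d ∧ x.val (.since f g) d)))) ∧
        (x.le → (bv y (.since f g) (d + 1) ↔
            (bv y g (d + 1) ∨ (bv y f (d + 1) ∧ x.val (.since f g) d)))))
  | .trig f g => baTrC x y f ∧ baTrC x y g ∧
      (∀ d, d ≤ (PLTL.trig f g).delta →
        ((¬ x.le ∧ ¬ (¬ x.inLoop ∧ y.inLoop ∧ 0 < d)) →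
          (y.val (.trig f g) d ↔
            (bv y g d ∧ (bv y f d ∨ x.val (.trig f g) d)))) ∧
        (x.le → (bv y (.trig f g) (d + 1) ↔
            (bv y g (d + 1) ∧ (bv y f (d + 1) ∨ x.val (.trig f g) d)))))

/-- Transitions of `B^ψ`: both states satisfy the invariant, `InLoop` is
monotone, and the temporal transition constraints hold. -/
def baTrans (ψ : PLTL AP) (x y : BASt AP) : Prop :=
  baState ψ x ∧ baState ψ y ∧ (x.inLoop → y.inLoop) ∧ baTrC x y ψ

/-- `ρ` is a run of `B^ψ` on the infinite word `α` over `2^AP`: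
an initialised path whose labelling (the atoms true at unrolling 0)
is exactly `α`. -/
def baRunOn (ψ : PLTL AP) (ρ : ℕ → BASt AP) (α : ℕ → Set AP) : Prop :=
  baInit ψ (ρ 0) ∧
  (∀ i, baTrans ψ (ρ i) (ρ (i + 1))) ∧
  (∀ i, ∀ p : AP, ((ρ i).val (.atom p) 0 ↔ p ∈ α i))

/-- `φ` is a subformula of `ψ`. -/
def PLTL.Subf (φ ψ : PLTL AP) : Prop :=
  φ ∈ (PLTL.rec (motive := fun _ => List (PLTL AP))
    (fun p => [.atom p]) (fun p => [.natom p])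
    (fun f g lf lg => .conj f g :: (lf ++ lg))
    (fun f g lf lg => .disj f g :: (lf ++ lg))
    (fun f lf => .next f :: lf)
    (fun f g lf lg => .untl f g :: (lf ++ lg))
    (fun f g lf lg => .rels f g :: (lf ++ lg))
    (fun f lf => .prev f :: lf)
    (fun f lf => .wprev f :: lf)
    (fun f g lf lg => .since f g :: (lf ++ lg))
    (fun f g lf lg => .trig f g :: (lf ++ lg)) ψ)

/-- The run `ρ` is accepting: every acceptance set of `B^ψ` — one for each
until subformula (`¬⟦ψ1Uψ2⟧^δ ∨ ⟦ψ2⟧^δ`), one for each release subformula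
(`⟦ψ1Rψ2⟧^δ ∨ ¬⟦ψ2⟧^δ`), and the set `{le}` — is visited infinitely often. -/
def baAccepting (ψ : PLTL AP) (ρ : ℕ → BASt AP) : Prop :=
  (∀ f g : PLTL AP, (PLTL.untl f g).Subf ψ →
    ∀ N, ∃ i, N ≤ i ∧
      (¬ bv (ρ i) (.untl f g) (PLTL.untl f g).delta ∨
        bv (ρ i) g (PLTL.untl f g).delta)) ∧
  (∀ f g : PLTL AP, (PLTL.rels f g).Subf ψ →
    ∀ N, ∃ i, N ≤ i ∧
      (bv (ρ i) (.rels f g) (PLTL.rels f g).delta ∨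
        ¬ bv (ρ i) g (PLTL.rels f g).delta)) ∧
  (∀ N, ∃ i, N ≤ i ∧ (ρ i).le)

/-- The language of `B^ψ`. -/
def baLang (ψ : PLTL AP) (α : ℕ → Set AP) : Prop :=
  ∃ ρ : ℕ → BASt AP, baRunOn ψ ρ α ∧ baAccepting ψ ρ

/-- `α ⊨ ψ`: satisfaction of `ψ` on the infinite word `α` over `2^AP`. -/
def wordSat (α : ℕ → Set AP) (ψ : PLTL AP) : Prop :=
  PLTL.sat (S := Set AP) id α ψ 0

end BMC

namespace BMC

variable {AP : Type}

def UU (F G : ℕ → Prop) (i : ℕ) : Prop := ∃ j, i ≤ j ∧ G j ∧ ∀ n, i ≤ n → n < j → F n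
def RR (F G : ℕ → Prop) (i : ℕ) : Prop := ∀ j, i ≤ j → (G j ∨ ∃ n, i ≤ n ∧ n < j ∧ F n)
def SS (F G : ℕ → Prop) (i : ℕ) : Prop := ∃ j, j ≤ i ∧ G j ∧ ∀ n, j < n → n ≤ i → F n
def TT (F G : ℕ → Prop) (i : ℕ) : Prop := ∀ j, j ≤ i → (G j ∨ ∃ n, j < n ∧ n ≤ i ∧ F n)

theorem RR_iff (F G : ℕ → Prop) (i : ℕ) :
    RR F G i ↔ ¬ UU (fun n => ¬ F n) (fun n => ¬ G n) i := by
  unfold RR UU; push Not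
  refine forall_congr' fun j => forall_congr' fun _ => ?_
  by_cases h : G j <;> simp [h]

theorem TT_iff (F G : ℕ → Prop) (i : ℕ) :
    TT F G i ↔ ¬ SS (fun n => ¬ F n) (fun n => ¬ G n) i := by
  unfold TT SS; push Not
  refine forall_congr' fun j => forall_congr' fun _ => ?_
  by_cases h : G j <;> simp [h]

theorem UU_rec (F G : ℕ → Prop) (i : ℕ) :
    UU F G i ↔ (G i ∨ (F i ∧ UU F G (i + 1))) := by
  constructor
  · rintro ⟨j, hij, hg, hf⟩
    rcases Nat.eq_or_lt_of_le hij with h | h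
    · subst h; exact Or.inl hg
    · exact Or.inr ⟨hf i le_rfl h, j, h, hg, fun n hn hn' => hf n (by omega) hn'⟩
  · rintro (h | ⟨hf, j, hij, hg, hF⟩)
    · exact ⟨i, le_rfl, h, fun n _ _ => by omega⟩
    · refine ⟨j, by omega, hg, fun n hn hn' => ?_⟩
      rcases Nat.eq_or_lt_of_le hn with h | h
      · subst h; exact hf
      · exact hF n h hn'

theorem RR_rec (F G : ℕ → Prop) (i : ℕ) :
    RR F G i ↔ (G i ∧ (F i ∨ RR F G (i + 1))) := by
  rw [RR_iff, RR_iff, UU_rec]; tauto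

theorem SS_zero (F G : ℕ → Prop) : SS F G 0 ↔ G 0 := by
  constructor
  · rintro ⟨j, hj, hg, _⟩
    obtain rfl : j = 0 := by omega
    exact hg
  · intro h
    exact ⟨0, le_rfl, h, fun n _ _ => by omega⟩

theorem SS_rec (F G : ℕ → Prop) (i : ℕ) :
    SS F G (i + 1) ↔ (G (i + 1) ∨ (F (i + 1) ∧ SS F G i)) := by
  constructor
  · rintro ⟨j, hij, hg, hf⟩
    rcases Nat.eq_or_lt_of_le hij with h | h
    · subst h; exact Or.inl hg
    · exact Or.inr ⟨hf _ h le_rfl, j, by omega, hg, fun n hn hn' => hf n hn (by omega)⟩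
  · rintro (h | ⟨hf, j, hij, hg, hF⟩)
    · exact ⟨i + 1, le_rfl, h, fun n _ _ => by omega⟩
    · refine ⟨j, by omega, hg, fun n hn hn' => ?_⟩
      rcases Nat.eq_or_lt_of_le hn' with h | h
      · subst h; exact hf
      · exact hF n hn (by omega)

theorem TT_zero (F G : ℕ → Prop) : TT F G 0 ↔ G 0 := by
  rw [TT_iff, SS_zero]; tauto

theorem TT_rec (F G : ℕ → Prop) (i : ℕ) :
    TT F G (i + 1) ↔ (G (i + 1) ∧ (F (i + 1) ∨ TT F G i)) := by
  rw [TT_iff, TT_iff, SS_rec]; tauto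

theorem UU_of_rec {F G u : ℕ → Prop} (h : ∀ i, u i ↔ (G i ∨ (F i ∧ u (i + 1))))
    (hacc : ∀ N, ∃ i, N ≤ i ∧ (¬ u i ∨ G i)) (i : ℕ) : u i ↔ UU F G i := by
  constructor
  · intro hu
    by_contra hn
    have key : ∀ k, u (i + k) ∧ ¬ UU F G (i + k) := by
      intro k
      induction k with
      | zero => exact ⟨hu, hn⟩
      | succ k ih =>
        obtain ⟨h1, h2⟩ := ih
        rw [h] at h1
        rw [UU_rec] at h2
        rw [← add_assoc]
        tauto
    obtain ⟨m, hm, hm'⟩ := hacc i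
    obtain ⟨k, rfl⟩ := Nat.exists_eq_add_of_le hm
    obtain ⟨h1, h2⟩ := key k
    rw [UU_rec] at h2
    tauto
  · rintro ⟨j, hij, hg, hf⟩
    obtain ⟨k, rfl⟩ := Nat.exists_eq_add_of_le hij
    clear hij
    induction k generalizing i with
    | zero => rw [h]; exact Or.inl hg
    | succ k ih =>
      rw [h]
      refine Or.inr ⟨hf i le_rfl (by omega), ih (i + 1) ?_ ?_⟩
      · rwa [show i + 1 + k = i + (k + 1) by omega]
      · intro n hn hn'; exact hf n (by omega) (by omega)

theorem RR_of_rec {F G u : ℕ → Prop} (h : ∀ i, u i ↔ (G i ∧ (F i ∨ u (i + 1))))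
    (hacc : ∀ N, ∃ i, N ≤ i ∧ (u i ∨ ¬ G i)) (i : ℕ) : u i ↔ RR F G i := by
  rw [RR_iff, ← UU_of_rec (u := fun n => ¬ u n), not_not]
  · intro i
    have := h i
    tauto
  · intro N
    obtain ⟨i, hi, h'⟩ := hacc N
    exact ⟨i, hi, by tauto⟩

theorem SS_of_rec {F G u : ℕ → Prop} (h0 : u 0 ↔ G 0)
    (h : ∀ i, u (i + 1) ↔ (G (i + 1) ∨ (F (i + 1) ∧ u i))) (i : ℕ) : u i ↔ SS F G i := by
  induction i with
  | zero => rw [h0, SS_zero]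
  | succ i ih => rw [h, SS_rec, ih]

theorem TT_of_rec {F G u : ℕ → Prop} (h0 : u 0 ↔ G 0)
    (h : ∀ i, u (i + 1) ↔ (G (i + 1) ∧ (F (i + 1) ∨ u i))) (i : ℕ) : u i ↔ TT F G i := by
  induction i with
  | zero => rw [h0, TT_zero]
  | succ i ih => rw [h, TT_rec, ih]

/-! periodicity -/

theorem UU_per {F G : ℕ → Prop} {n p : ℕ} (hF : ∀ i, n ≤ i → (F (i + p) ↔ F i))
    (hG : ∀ i, n ≤ i → (G (i + p) ↔ G i)) (i : ℕ) (hi : n ≤ i) :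
    UU F G (i + p) ↔ UU F G i := by
  constructor
  · rintro ⟨j, hij, hg, hf⟩
    obtain ⟨k, rfl⟩ : ∃ k, j = k + p := ⟨j - p, by omega⟩
    exact ⟨k, by omega, (hG k (by omega)).1 hg, fun m hm hm' =>
      (hF m (by omega)).1 (hf (m + p) (by omega) (by omega))⟩
  · rintro ⟨j, hij, hg, hf⟩
    refine ⟨j + p, by omega, (hG j (by omega)).2 hg, fun m hm hm' => ?_⟩
    obtain ⟨k, rfl⟩ : ∃ k, m = k + p := ⟨m - p, by omega⟩
    exact (hF k (by omega)).2 (hf k (by omega) (by omega))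

theorem RR_per {F G : ℕ → Prop} {n p : ℕ} (hF : ∀ i, n ≤ i → (F (i + p) ↔ F i))
    (hG : ∀ i, n ≤ i → (G (i + p) ↔ G i)) (i : ℕ) (hi : n ≤ i) :
    RR F G (i + p) ↔ RR F G i := by
  rw [RR_iff, RR_iff, UU_per (n := n) _ _ i hi]
  · intro i hi; simp only [hF i hi]
  · intro i hi; simp only [hG i hi]

theorem SS_per {F G : ℕ → Prop} {n p : ℕ} (hp : 0 < p) (hF : ∀ i, n ≤ i → (F (i + p) ↔ F i))
    (hG : ∀ i, n ≤ i → (G (i + p) ↔ G i)) (i : ℕ) (hi : n + p ≤ i) :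
    SS F G (i + p) ↔ SS F G i := by
  constructor
  · rintro ⟨j, hij, hg, hf⟩
    by_cases hj : j < n + p
    · exact ⟨j, by omega, hg, fun m hm hm' => hf m hm (by omega)⟩
    · obtain ⟨k, rfl⟩ : ∃ k, j = k + p := ⟨j - p, by omega⟩
      exact ⟨k, by omega, (hG k (by omega)).1 hg, fun m hm hm' =>
        (hF m (by omega)).1 (hf (m + p) (by omega) (by omega))⟩
  · rintro ⟨j, hij, hg, hf⟩
    by_cases hj : j < n
    · refine ⟨j, by omega, hg, fun m hm hm' => ?_⟩
      by_cases hmi : m ≤ i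
      · exact hf m hm hmi
      · obtain ⟨k, rfl⟩ : ∃ k, m = k + p := ⟨m - p, by omega⟩
        exact (hF k (by omega)).2 (hf k (by omega) (by omega))
    · refine ⟨j + p, by omega, (hG j (by omega)).2 hg, fun m hm hm' => ?_⟩
      obtain ⟨k, rfl⟩ : ∃ k, m = k + p := ⟨m - p, by omega⟩
      exact (hF k (by omega)).2 (hf k (by omega) (by omega))

theorem TT_per {F G : ℕ → Prop} {n p : ℕ} (hp : 0 < p) (hF : ∀ i, n ≤ i → (F (i + p) ↔ F i))
    (hG : ∀ i, n ≤ i → (G (i + p) ↔ G i)) (i : ℕ) (hi : n + p ≤ i) :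
    TT F G (i + p) ↔ TT F G i := by
  rw [TT_iff, TT_iff, SS_per (n := n) hp _ _ i hi]
  · intro i hi; simp only [hF i hi]
  · intro i hi; simp only [hG i hi]

abbrev ws (α : ℕ → Set AP) (φ : PLTL AP) (i : ℕ) : Prop := PLTL.sat (S := Set AP) id α φ i

theorem ws_untl (α : ℕ → Set AP) (f g : PLTL AP) (i : ℕ) :
    ws α (.untl f g) i ↔ UU (ws α f) (ws α g) i := Iff.rfl
theorem ws_rels (α : ℕ → Set AP) (f g : PLTL AP) (i : ℕ) :
    ws α (.rels f g) i ↔ RR (ws α f) (ws α g) i := Iff.rfl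
theorem ws_since (α : ℕ → Set AP) (f g : PLTL AP) (i : ℕ) :
    ws α (.since f g) i ↔ SS (ws α f) (ws α g) i := Iff.rfl
theorem ws_trig (α : ℕ → Set AP) (f g : PLTL AP) (i : ℕ) :
    ws α (.trig f g) i ↔ TT (ws α f) (ws α g) i := Iff.rfl

theorem ws_per (α : ℕ → Set AP) (b p : ℕ) (hp : 0 < p) (hα : ∀ i, b ≤ i → α (i + p) = α i)
    (φ : PLTL AP) (D : ℕ) (hD : φ.delta ≤ D) (i : ℕ) (hi : b + D * p ≤ i) :
    ws α φ (i + p) ↔ ws α φ i := by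
  induction φ generalizing D i with
  | atom q => simp only [ws, PLTL.sat, hα i (by omega)]
  | natom q => simp only [ws, PLTL.sat, hα i (by omega)]
  | conj f g hf hg =>
    simp only [PLTL.delta, max_le_iff] at hD
    exact and_congr (hf D hD.1 i hi) (hg D hD.2 i hi)
  | disj f g hf hg =>
    simp only [PLTL.delta, max_le_iff] at hD
    exact or_congr (hf D hD.1 i hi) (hg D hD.2 i hi)
  | next f hf =>
    have := hf D hD (i + 1) (by omega)
    rw [show i + 1 + p = i + p + 1 by omega] at this
    exact this
  | untl f g hf hg =>
    simp only [PLTL.delta, max_le_iff] at hD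
    exact UU_per (hf D hD.1) (hg D hD.2) i hi
  | rels f g hf hg =>
    simp only [PLTL.delta, max_le_iff] at hD
    exact RR_per (hf D hD.1) (hg D hD.2) i hi
  | prev f hf =>
    obtain ⟨E, rfl⟩ : ∃ E, D = E + 1 := ⟨D - 1, by simp only [PLTL.delta] at hD; omega⟩
    simp only [PLTL.delta] at hD
    rw [Nat.succ_mul] at hi
    have := hf E (by omega) (i - 1) (by omega)
    rw [show i - 1 + p = i + p - 1 by omega] at this
    simp only [ws] at this
    simp only [ws, PLTL.sat]
    rw [this]
    simp only [show 0 < i + p by omega, show 0 < i by omega]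
  | wprev f hf =>
    obtain ⟨E, rfl⟩ : ∃ E, D = E + 1 := ⟨D - 1, by simp only [PLTL.delta] at hD; omega⟩
    simp only [PLTL.delta] at hD
    rw [Nat.succ_mul] at hi
    have := hf E (by omega) (i - 1) (by omega)
    rw [show i - 1 + p = i + p - 1 by omega] at this
    simp only [ws] at this
    simp only [ws, PLTL.sat]
    rw [this]
    simp only [show ¬ (i + p = 0) by omega, show ¬ (i = 0) by omega]
  | since f g hf hg =>
    obtain ⟨E, rfl⟩ : ∃ E, D = E + 1 := ⟨D - 1, by simp only [PLTL.delta] at hD; omega⟩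
    simp only [PLTL.delta] at hD
    rw [Nat.succ_mul] at hi
    exact SS_per (n := b + E * p) hp (hf E (by omega)) (hg E (by omega)) i (by omega)
  | trig f g hf hg =>
    obtain ⟨E, rfl⟩ : ∃ E, D = E + 1 := ⟨D - 1, by simp only [PLTL.delta] at hD; omega⟩
    simp only [PLTL.delta] at hD
    rw [Nat.succ_mul] at hi
    exact TT_per (n := b + E * p) hp (hf E (by omega)) (hg E (by omega)) i (by omega)

theorem ws_per_mul (α : ℕ → Set AP) (b p : ℕ) (hp : 0 < p)
    (hα : ∀ i, b ≤ i → α (i + p) = α i)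
    (φ : PLTL AP) (D : ℕ) (hD : φ.delta ≤ D) (i : ℕ) (hi : b + D * p ≤ i) (k : ℕ) :
    ws α φ (i + k * p) ↔ ws α φ i := by
  induction k with
  | zero => simp
  | succ k ih =>
    rw [← ih, Nat.succ_mul, ← add_assoc]
    exact ws_per α b p hp hα φ D hD _ (by omega)

/-! building runs -/

theorem val_eq (x : BASt AP) (φ : PLTL AP) {d : ℕ} (h : d ≤ φ.delta) :
    x.val φ d = bv x φ d := by
  unfold bv; rw [min_eq_left h]

section build
variable {α : ℕ → Set AP} {x y : BASt AP} {P Q : ℕ → ℕ}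

theorem build_st (hx : ∀ φ d, bv x φ d ↔ ws α φ (P d)) (φ : PLTL AP) : baStC x φ := by
  induction φ with
  | atom q => trivial
  | natom q => simp only [baStC, hx]; rfl
  | conj f g hf hg =>
    refine ⟨hf, hg, fun d hd => ?_⟩
    rw [val_eq _ _ hd, hx, hx, hx]; rfl
  | disj f g hf hg =>
    refine ⟨hf, hg, fun d hd => ?_⟩
    rw [val_eq _ _ hd, hx, hx, hx]; rfl
  | next f hf => exact hf
  | prev f hf => exact hf
  | wprev f hf => exact hf
  | untl f g hf hg => exact ⟨hf, hg⟩
  | rels f g hf hg => exact ⟨hf, hg⟩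
  | since f g hf hg => exact ⟨hf, hg⟩
  | trig f g hf hg => exact ⟨hf, hg⟩

theorem build_init (hx : ∀ φ d, bv x φ d ↔ ws α φ (P d)) (h0 : P 0 = 0) (φ : PLTL AP) :
    baInitC x φ := by
  induction φ with
  | atom q => trivial
  | natom q => trivial
  | conj f g hf hg => exact ⟨hf, hg⟩
  | disj f g hf hg => exact ⟨hf, hg⟩
  | next f hf => exact hf
  | prev f hf =>
    refine ⟨hf, ?_⟩
    rw [val_eq _ _ (Nat.zero_le _), hx, h0]
    simp [ws, PLTL.sat]
  | wprev f hf =>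
    refine ⟨hf, ?_⟩
    rw [val_eq _ _ (Nat.zero_le _), hx, h0]
    simp [ws, PLTL.sat]
  | untl f g hf hg => exact ⟨hf, hg⟩
  | rels f g hf hg => exact ⟨hf, hg⟩
  | since f g hf hg =>
    refine ⟨hf, hg, ?_⟩
    rw [val_eq _ _ (Nat.zero_le _), hx, hx, h0]
    exact SS_zero _ _
  | trig f g hf hg =>
    refine ⟨hf, hg, ?_⟩
    rw [val_eq _ _ (Nat.zero_le _), hx, hx, h0]
    exact TT_zero _ _

theorem build_tr (hx : ∀ φ d, bv x φ d ↔ ws α φ (P d)) (hy : ∀ φ d, bv y φ d ↔ ws α φ (Q d))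
    (h1 : ∀ d, (¬ x.le ∧ ¬ (¬ x.inLoop ∧ y.inLoop ∧ 0 < d)) → Q d = P d + 1)
    (h2 : ∀ d, x.le → Q (d + 1) = P d + 1) (φ : PLTL AP) :
    baTrC x y φ := by
  induction φ with
  | atom q => trivial
  | natom q => trivial
  | conj f g hf hg => exact ⟨hf, hg⟩
  | disj f g hf hg => exact ⟨hf, hg⟩
  | next f hf =>
    refine ⟨hf, fun d hd => ⟨fun h => ?_, fun h => ?_⟩⟩
    · rw [val_eq _ _ hd, hx, hy, h1 d h]; rfl
    · rw [val_eq _ _ hd, hx, hy, h2 d h]; rfl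
  | prev f hf =>
    refine ⟨hf, fun d hd => ⟨fun h => ?_, fun h => ?_⟩⟩
    · rw [val_eq _ _ hd, hx, hy, h1 d h]; simp [ws, PLTL.sat]
    · rw [hx, hy, h2 d h]; simp [ws, PLTL.sat]
  | wprev f hf =>
    refine ⟨hf, fun d hd => ⟨fun h => ?_, fun h => ?_⟩⟩
    · rw [val_eq _ _ hd, hx, hy, h1 d h]; simp [ws, PLTL.sat]
    · rw [hx, hy, h2 d h]; simp [ws, PLTL.sat]
  | untl f g hf hg =>
    refine ⟨hf, hg, fun d hd => ⟨fun h => ?_, fun h => ?_⟩⟩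
    · rw [val_eq _ _ hd, hx, hx, hx, hy, h1 d h]; exact UU_rec _ _ _
    · rw [val_eq _ _ hd, hx, hx, hx, hy, h2 d h]; exact UU_rec _ _ _
  | rels f g hf hg =>
    refine ⟨hf, hg, fun d hd => ⟨fun h => ?_, fun h => ?_⟩⟩
    · rw [val_eq _ _ hd, hx, hx, hx, hy, h1 d h]; exact RR_rec _ _ _
    · rw [val_eq _ _ hd, hx, hx, hx, hy, h2 d h]; exact RR_rec _ _ _
  | since f g hf hg =>
    refine ⟨hf, hg, fun d hd => ⟨fun h => ?_, fun h => ?_⟩⟩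
    · rw [val_eq _ _ hd, val_eq _ _ hd, hx, hy, hy, hy, h1 d h]; exact SS_rec _ _ _
    · rw [val_eq _ _ hd, hx, hy, hy, hy, h2 d h]; exact SS_rec _ _ _
  | trig f g hf hg =>
    refine ⟨hf, hg, fun d hd => ⟨fun h => ?_, fun h => ?_⟩⟩
    · rw [val_eq _ _ hd, val_eq _ _ hd, hx, hy, hy, hy, h1 d h]; exact TT_rec _ _ _
    · rw [val_eq _ _ hd, hx, hy, hy, hy, h2 d h]; exact TT_rec _ _ _

end build

theorem build_run (ψ : PLTL AP) (α : ℕ → Set AP) (ρ : ℕ → BASt AP) (pos : ℕ → ℕ → ℕ)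
    (hv : ∀ i φ d, bv (ρ i) φ d ↔ ws α φ (pos i d)) (h0 : pos 0 0 = 0)
    (hle : ∀ i, (ρ i).le → (ρ i).inLoop)
    (hin : ∀ i, (ρ i).inLoop → (ρ (i + 1)).inLoop)
    (h1 : ∀ i d, (¬ (ρ i).le ∧ ¬ (¬ (ρ i).inLoop ∧ (ρ (i + 1)).inLoop ∧ 0 < d)) →
      pos (i + 1) d = pos i d + 1)
    (h2 : ∀ i d, (ρ i).le → pos (i + 1) (d + 1) = pos i d + 1)
    (hα : ∀ i, α (pos i 0) = α i) (hs : wordSat α ψ) : baRunOn ψ ρ α := by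
  have hst : ∀ i, baState ψ (ρ i) := fun i => ⟨hle i, build_st (hv i) ψ⟩
  refine ⟨⟨hst 0, build_init (hv 0) h0 ψ, ?_⟩,
    fun i => ⟨hst i, hst (i + 1), hin i, build_tr (hv i) (hv (i + 1)) (h1 i) (h2 i) ψ⟩, ?_⟩
  · rw [hv, h0]; exact hs
  · intro i q
    rw [val_eq _ _ (Nat.zero_le _), hv, ← hα i]
    rfl

theorem build_acc (ψ : PLTL AP) (α : ℕ → Set AP) (ρ : ℕ → BASt AP) (B : ℕ) (c : ℕ → ℕ)
    (hv : ∀ i, B ≤ i → ∀ D φ, φ.delta ≤ D → (bv (ρ i) φ D ↔ ws α φ (i + c D)))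
    (hle : ∀ N, ∃ i, N ≤ i ∧ (ρ i).le) : baAccepting ψ ρ := by
  refine ⟨fun f g _ N => ?_, fun f g _ N => ?_, hle⟩
  · by_contra hcon
    push Not at hcon
    have h1 := (hcon (max N B) (le_max_left _ _)).1
    rw [hv _ (le_max_right _ _) _ _ le_rfl, ws_untl] at h1
    obtain ⟨j, hj, hg, _⟩ := h1
    have hm1 := le_max_left N B
    have hm2 := le_max_right N B
    set D := (PLTL.untl f g).delta with hD
    apply (hcon (j - c D) (by omega)).2
    rw [hv _ (by omega) D g (by rw [hD]; exact le_max_right _ _),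
      show j - c D + c D = j by omega]
    exact hg
  · by_contra hcon
    push Not at hcon
    have hm1 := le_max_left N B
    have hm2 := le_max_right N B
    apply (hcon (max N B) (le_max_left _ _)).1
    rw [hv _ (le_max_right _ _) _ _ le_rfl, ws_rels]
    intro j hj
    left
    set D := (PLTL.rels f g).delta with hD
    have := (hcon (j - c D) (by omega)).2
    rw [hv _ (by omega) D g (by rw [hD]; exact le_max_right _ _),
      show j - c D + c D = j by omega] at this
    exact this

theorem complete (ψ : PLTL AP) (α : ℕ → Set AP) (hs : wordSat α ψ) : baLang ψ α := by
  refine ⟨fun i => ⟨fun φ _ => ws α φ i, True, True⟩, ?_, ?_⟩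
  · refine build_run ψ α _ (fun i _ => i) ?_ rfl ?_ ?_ ?_ ?_ ?_ hs <;> simp [bv]
  · refine build_acc ψ α _ 0 (fun _ => 0) ?_ ?_
    · simp [bv]
    · intro N; exact ⟨N, le_rfl, trivial⟩

def can (b p i : ℕ) : ℕ := if i < b then i else b + (i - b) % p

def tpos (b p i d : ℕ) : ℕ := if i < b then i else can b p i + d * p

def trun (α : ℕ → Set AP) (b p i : ℕ) : BASt AP :=
  ⟨fun φ d => ws α φ (tpos b p (can b p i) d), b ≤ can b p i, can b p i + 1 = b + p⟩

theorem can_ge {b p i : ℕ} (h : b ≤ i) : can b p i = b + (i - b) % p := by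
  simp [can, Nat.not_lt.2 h]

theorem can_lt {b p i : ℕ} (h : i < b) : can b p i = i := by simp [can, h]

theorem can_dec {b p i : ℕ} (h : b ≤ i) : can b p i + ((i - b) / p) * p = i := by
  rw [can_ge h]
  have := Nat.mod_add_div' (i - b) p
  omega

theorem can_bd {b p i : ℕ} (hp : 0 < p) (h : b ≤ i) : b ≤ can b p i ∧ can b p i < b + p := by
  rw [can_ge h]
  have := Nat.mod_lt (i - b) hp
  omega

theorem can_can {b p i : ℕ} (hp : 0 < p) : can b p (can b p i) = can b p i := by
  by_cases h : i < b
  · simp [can_lt h]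
  · have h' := Nat.le_of_not_lt h
    rw [can_ge (can_bd hp h').1, can_ge h']
    simp

theorem tpos_lt {b p i d : ℕ} (h : i < b) : tpos b p (can b p i) d = i := by
  rw [can_lt h]; simp [tpos, h]

theorem tpos_ge {b p i d : ℕ} (hp : 0 < p) (h : b ≤ i) :
    tpos b p (can b p i) d = can b p i + d * p := by
  have := (can_bd hp h).1
  rw [tpos, if_neg (by omega), can_can hp]

theorem can_succ {b p i : ℕ} (hp : 0 < p) (h : b ≤ i) :
    can b p (i + 1) = if can b p i + 1 = b + p then b else can b p i + 1 := by
  rw [can_ge h, can_ge (by omega : b ≤ i + 1), show i + 1 - b = (i - b) + 1 by omega]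
  have hm := Nat.mod_lt (i - b) hp
  have hd := Nat.mod_add_div' (i - b) p
  split_ifs with hc
  · have : (i - b) % p + 1 = p := by omega
    rw [show i - b + 1 = p + (i - b) / p * p by omega]
    simp
  · rw [show i - b + 1 = ((i - b) % p + 1) + (i - b) / p * p by omega, Nat.add_mul_mod_self_right,
      Nat.mod_eq_of_lt (by omega)]
    omega

theorem tight (ψ : PLTL AP) (α : ℕ → Set AP) (b p : ℕ) (hp : 0 < p)
    (hα : ∀ i, b ≤ i → α (i + p) = α i) (hs : wordSat α ψ) :
    ∃ ρ : ℕ → BASt AP, baRunOn ψ ρ α ∧ baAccepting ψ ρ ∧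
        ∀ i, b ≤ i → ρ (i + p) = ρ i := by
  have hin : ∀ i, (trun α b p i).inLoop ↔ b ≤ i := by
    intro i
    show b ≤ can b p i ↔ b ≤ i
    by_cases h : i < b
    · rw [can_lt h]
    · have := can_bd hp (Nat.le_of_not_lt h)
      omega
  have hle : ∀ i, (trun α b p i).le ↔ can b p i + 1 = b + p := fun i => Iff.rfl
  have hleb : ∀ i, (trun α b p i).le → b ≤ i := by
    intro i h
    rw [hle] at h
    by_contra hb
    rw [can_lt (by omega)] at h
    omega
  have hv : ∀ i φ d, bv (trun α b p i) φ d ↔ ws α φ (tpos b p (can b p i) d) := by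
    intro i φ d
    show ws α φ (tpos b p (can b p i) (min d φ.delta)) ↔ _
    by_cases h : i < b
    · rw [tpos_lt h, tpos_lt h]
    · have h' := Nat.le_of_not_lt h
      rw [tpos_ge hp h', tpos_ge hp h']
      rcases le_total d φ.delta with hd | hd
      · rw [min_eq_left hd]
      · rw [min_eq_right hd]
        obtain ⟨k, rfl⟩ := Nat.exists_eq_add_of_le hd
        rw [Nat.add_mul, ← add_assoc]
        have := (can_bd hp h').1
        exact (ws_per_mul α b p hp hα φ _ le_rfl _ (by omega) k).symm
  refine ⟨trun α b p, ?_, ?_, ?_⟩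
  · refine build_run ψ α _ (fun i d => tpos b p (can b p i) d) hv ?_ ?_ ?_ ?_ ?_ ?_ hs
    · by_cases h : 0 < b
      · exact tpos_lt h
      · obtain rfl : b = 0 := by omega
        simp [tpos, can]
    · intro i h; exact (hin i).2 (hleb i h)
    · intro i h; rw [hin] at *; omega
    · intro i d
      rw [hin, hin, hle]
      rintro ⟨h1, h2⟩
      by_cases h : i < b
      · rw [tpos_lt h]
        by_cases h' : i + 1 < b
        · rw [tpos_lt h']
        · have hd : d = 0 := by omega
          have hb : b = i + 1 := by omega
          subst hd
          rw [tpos_ge hp (by omega), can_ge (by omega), hb]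
          simp
      · rw [tpos_ge hp (by omega), tpos_ge hp (by omega), can_succ hp (by omega), if_neg h1]
        omega
    · intro i d h
      have hb := hleb i h
      rw [hle] at h
      rw [tpos_ge hp (by omega), tpos_ge hp (by omega), can_succ hp (by omega), if_pos h,
        Nat.succ_mul]
      omega
    · intro i
      by_cases h : i < b
      · rw [tpos_lt h]
      · have h' := Nat.le_of_not_lt h
        rw [tpos_ge hp h', Nat.zero_mul, Nat.add_zero]
        conv_rhs => rw [← can_dec (p := p) h']
        have := (can_bd hp h').1
        generalize (i - b) / p = k
        induction k with
        | zero => simp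
        | succ k ih => rw [Nat.succ_mul, ← add_assoc, hα _ (by omega)]; exact ih
  · refine build_acc ψ α _ b (fun D => D * p) ?_ ?_
    · intro i hi D φ hD
      rw [hv, tpos_ge hp hi]
      have := (can_bd hp hi).1
      have h2 := ws_per_mul α b p hp hα φ D hD (can b p i + D * p) (by omega) ((i - b) / p)
      rw [← h2, show can b p i + D * p + (i - b) / p * p = i + D * p by
        have := can_dec (p := p) hi
        omega]
    · intro N
      refine ⟨b + ((p - 1) + N * p), ?_, ?_⟩
      · have := Nat.le_mul_of_pos_right N hp
        omega
      · rw [hle, can_ge (by omega), Nat.add_sub_cancel_left, Nat.add_mul_mod_self_right,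
          Nat.mod_eq_of_lt (by omega)]
        omega
  · intro i hi
    have : can b p (i + p) = can b p i := by
      rw [can_ge hi, can_ge (by omega), show i + p - b = i - b + p by omega, Nat.add_mod_right]
    simp only [trun, this]

/-! soundness -/

open Classical in
noncomputable def cnt (ρ : ℕ → BASt AP) : ℕ → ℕ
  | 0 => 0
  | i + 1 => if (ρ i).le then cnt ρ i + 1 else cnt ρ i

theorem bv_congr (x : BASt AP) (φ : PLTL AP) {d e : ℕ}
    (h : min d φ.delta = min e φ.delta) : bv x φ d = bv x φ e := by
  unfold bv; rw [h]

theorem cnt_mono (ρ : ℕ → BASt AP) : Monotone (cnt ρ) := by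
  refine monotone_nat_of_le_succ fun i => ?_
  rw [cnt]; split_ifs <;> omega

theorem cnt_inLoop (ρ : ℕ → BASt AP) (hle : ∀ i, (ρ i).le → (ρ i).inLoop)
    (hin : ∀ i, (ρ i).inLoop → (ρ (i + 1)).inLoop) (i : ℕ) (h : 0 < cnt ρ i) :
    (ρ i).inLoop := by
  induction i with
  | zero => simp [cnt] at h
  | succ i ih =>
    apply hin
    rw [cnt] at h
    split_ifs at h with h'
    · exact hle i h'
    · exact ih h

theorem cnt_unb (ρ : ℕ → BASt AP) (hacc : ∀ N, ∃ i, N ≤ i ∧ (ρ i).le) (D : ℕ) :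
    ∃ N, ∀ i, N ≤ i → D ≤ cnt ρ i := by
  induction D with
  | zero => exact ⟨0, fun _ _ => Nat.zero_le _⟩
  | succ D ih =>
    obtain ⟨N, hN⟩ := ih
    obtain ⟨j, hj, hl⟩ := hacc N
    refine ⟨j + 1, fun i hi => ?_⟩
    have h1 := cnt_mono ρ hi
    have h2 := hN j hj
    rw [cnt, if_pos hl] at h1
    omega

theorem sound_aux (α : ℕ → Set AP) (ρ : ℕ → BASt AP)
    (hle : ∀ i, (ρ i).le → (ρ i).inLoop)
    (hin : ∀ i, (ρ i).inLoop → (ρ (i + 1)).inLoop)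
    (hat : ∀ i, ∀ p : AP, ((ρ i).val (.atom p) 0 ↔ p ∈ α i))
    (φ : PLTL AP) (hI : baInitC (ρ 0) φ) (hS : ∀ i, baStC (ρ i) φ)
    (hT : ∀ i, baTrC (ρ i) (ρ (i + 1)) φ) (hA : baAccepting φ ρ) :
    ∀ i, bv (ρ i) φ (cnt ρ i) ↔ ws α φ i := by
  have hstep : ∀ i, ((ρ i).le ∧ cnt ρ (i + 1) = cnt ρ i + 1) ∨
      (cnt ρ (i + 1) = cnt ρ i ∧ ∀ D, ¬ (ρ i).le ∧
        ¬ (¬ (ρ i).inLoop ∧ (ρ (i + 1)).inLoop ∧ 0 < min (cnt ρ i) D)) := by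
    intro i
    by_cases h : (ρ i).le
    · left; exact ⟨h, by rw [cnt, if_pos h]⟩
    · right
      refine ⟨by rw [cnt, if_neg h], fun D => ⟨h, ?_⟩⟩
      rintro ⟨h1, _, h3⟩
      exact h1 (cnt_inLoop ρ hle hin i (by omega))
  have h0 : cnt ρ 0 = 0 := rfl
  have hunb := cnt_unb ρ hA.2.2
  induction φ with
  | atom q =>
    intro i
    simp only [bv, PLTL.delta, Nat.min_zero, hat]; rfl
  | natom q =>
    intro i
    have := hS i
    simp only [baStC, bv, PLTL.delta, Nat.min_zero, hat] at this
    simp only [bv, PLTL.delta, Nat.min_zero, this]; rfl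
  | conj f g hf hg =>
    intro i
    have hf := hf hI.1 (fun i => (hS i).1) (fun i => (hT i).1) ⟨fun a b h => hA.1 a b
      (List.mem_cons_of_mem _ (List.mem_append_left _ h)), fun a b h => hA.2.1 a b
      (List.mem_cons_of_mem _ (List.mem_append_left _ h)), hA.2.2⟩
    have hg := hg hI.2 (fun i => (hS i).2.1) (fun i => (hT i).2) ⟨fun a b h => hA.1 a b
      (List.mem_cons_of_mem _ (List.mem_append_right _ h)), fun a b h => hA.2.1 a b
      (List.mem_cons_of_mem _ (List.mem_append_right _ h)), hA.2.2⟩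
    have := (hS i).2.2 _ (min_le_right (cnt ρ i) _)
    rw [bv_congr _ f (e := cnt ρ i) (by simp only [PLTL.delta]; omega),
      bv_congr _ g (e := cnt ρ i) (by simp only [PLTL.delta]; omega), hf, hg] at this
    exact this
  | disj f g hf hg =>
    intro i
    have hf := hf hI.1 (fun i => (hS i).1) (fun i => (hT i).1) ⟨fun a b h => hA.1 a b
      (List.mem_cons_of_mem _ (List.mem_append_left _ h)), fun a b h => hA.2.1 a b
      (List.mem_cons_of_mem _ (List.mem_append_left _ h)), hA.2.2⟩
    have hg := hg hI.2 (fun i => (hS i).2.1) (fun i => (hT i).2) ⟨fun a b h => hA.1 a b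
      (List.mem_cons_of_mem _ (List.mem_append_right _ h)), fun a b h => hA.2.1 a b
      (List.mem_cons_of_mem _ (List.mem_append_right _ h)), hA.2.2⟩
    have := (hS i).2.2 _ (min_le_right (cnt ρ i) _)
    rw [bv_congr _ f (e := cnt ρ i) (by simp only [PLTL.delta]; omega),
      bv_congr _ g (e := cnt ρ i) (by simp only [PLTL.delta]; omega), hf, hg] at this
    exact this
  | next f hf =>
    have hf := hf hI hS (fun i => (hT i).1) ⟨fun a b h => hA.1 a b
      (List.mem_cons_of_mem _ h), fun a b h => hA.2.1 a b
      (List.mem_cons_of_mem _ h), hA.2.2⟩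
    intro i
    have := (hT i).2 _ (min_le_right (cnt ρ i) _)
    show _ ↔ ws α f (i + 1)
    rw [← hf]
    rcases hstep i with ⟨h, hc⟩ | ⟨hc, h⟩
    · have := this.2 h
      rw [bv_congr _ f (e := cnt ρ i + 1) (by simp only [PLTL.delta]; omega)] at this
      rw [hc]; exact this
    · have := this.1 (h _)
      rw [bv_congr _ f (e := cnt ρ i) (by simp only [PLTL.delta]; omega)] at this
      rw [hc]; exact this
  | prev f hf =>
    have hf := hf hI.1 hS (fun i => (hT i).1) ⟨fun a b h => hA.1 a b
      (List.mem_cons_of_mem _ h), fun a b h => hA.2.1 a b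
      (List.mem_cons_of_mem _ h), hA.2.2⟩
    intro i
    cases i with
    | zero =>
      have := hI.2
      simp only [ws, PLTL.sat, bv, h0, Nat.zero_min]
      simp [this]
    | succ i =>
      have := (hT i).2 _ (min_le_right (cnt ρ i) _)
      have e : ws α (.prev f) (i + 1) ↔ ws α f i := by simp [ws, PLTL.sat]
      rw [e, ← hf]
      rcases hstep i with ⟨h, hc⟩ | ⟨hc, h⟩
      · have := this.2 h
        rw [bv_congr _ f (e := cnt ρ i) (by simp only [PLTL.delta]; omega),
          bv_congr _ _ (e := cnt ρ i + 1) (by omega)] at this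
        rw [hc]; exact this
      · have := this.1 (h _)
        rw [bv_congr _ f (e := cnt ρ i) (by simp only [PLTL.delta]; omega)] at this
        rw [hc]; exact this
  | wprev f hf =>
    have hf := hf hI.1 hS (fun i => (hT i).1) ⟨fun a b h => hA.1 a b
      (List.mem_cons_of_mem _ h), fun a b h => hA.2.1 a b
      (List.mem_cons_of_mem _ h), hA.2.2⟩
    intro i
    cases i with
    | zero =>
      have := hI.2
      simp only [ws, PLTL.sat, bv, h0, Nat.zero_min]
      simp [this]
    | succ i =>
      have := (hT i).2 _ (min_le_right (cnt ρ i) _)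
      have e : ws α (.wprev f) (i + 1) ↔ ws α f i := by simp [ws, PLTL.sat]
      rw [e, ← hf]
      rcases hstep i with ⟨h, hc⟩ | ⟨hc, h⟩
      · have := this.2 h
        rw [bv_congr _ f (e := cnt ρ i) (by simp only [PLTL.delta]; omega),
          bv_congr _ _ (e := cnt ρ i + 1) (by omega)] at this
        rw [hc]; exact this
      · have := this.1 (h _)
        rw [bv_congr _ f (e := cnt ρ i) (by simp only [PLTL.delta]; omega)] at this
        rw [hc]; exact this
  | untl f g hf hg =>
    have hf := hf hI.1 (fun i => (hS i).1) (fun i => (hT i).1) ⟨fun a b h => hA.1 a b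
      (List.mem_cons_of_mem _ (List.mem_append_left _ h)), fun a b h => hA.2.1 a b
      (List.mem_cons_of_mem _ (List.mem_append_left _ h)), hA.2.2⟩
    have hg := hg hI.2 (fun i => (hS i).2) (fun i => (hT i).2.1) ⟨fun a b h => hA.1 a b
      (List.mem_cons_of_mem _ (List.mem_append_right _ h)), fun a b h => hA.2.1 a b
      (List.mem_cons_of_mem _ (List.mem_append_right _ h)), hA.2.2⟩
    refine UU_of_rec (F := ws α f) (G := ws α g) (fun i => ?_) (fun N => ?_)
    · have := (hT i).2.2 _ (min_le_right (cnt ρ i) _)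
      rw [← hf, ← hg]
      rw [bv_congr _ f (e := cnt ρ i) (by simp only [PLTL.delta]; omega),
        bv_congr _ g (e := cnt ρ i) (by simp only [PLTL.delta]; omega)] at this
      rcases hstep i with ⟨h, hc⟩ | ⟨hc, h⟩
      · have := this.2 h
        rw [bv_congr _ (.untl f g) (e := cnt ρ i + 1) (by omega)] at this
        rw [hc]; exact this
      · have := this.1 (h _)
        rw [bv_congr _ (.untl f g) (e := cnt ρ i) (by omega)] at this
        rw [hc]; exact this
    · obtain ⟨M, hM⟩ := hunb (PLTL.untl f g).delta
      obtain ⟨i, hi, h⟩ := hA.1 f g (List.mem_cons_self) (max N M)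
      have hd := hM i ((le_max_right _ _).trans hi)
      refine ⟨i, (le_max_left _ _).trans hi, ?_⟩
      rw [← hg]
      rw [bv_congr _ (.untl f g) (e := cnt ρ i) (by omega),
        bv_congr _ g (e := cnt ρ i) (by simp only [PLTL.delta] at hd ⊢; omega)] at h
      exact h
  | rels f g hf hg =>
    have hf := hf hI.1 (fun i => (hS i).1) (fun i => (hT i).1) ⟨fun a b h => hA.1 a b
      (List.mem_cons_of_mem _ (List.mem_append_left _ h)), fun a b h => hA.2.1 a b
      (List.mem_cons_of_mem _ (List.mem_append_left _ h)), hA.2.2⟩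
    have hg := hg hI.2 (fun i => (hS i).2) (fun i => (hT i).2.1) ⟨fun a b h => hA.1 a b
      (List.mem_cons_of_mem _ (List.mem_append_right _ h)), fun a b h => hA.2.1 a b
      (List.mem_cons_of_mem _ (List.mem_append_right _ h)), hA.2.2⟩
    refine RR_of_rec (F := ws α f) (G := ws α g) (fun i => ?_) (fun N => ?_)
    · have := (hT i).2.2 _ (min_le_right (cnt ρ i) _)
      rw [← hf, ← hg]
      rw [bv_congr _ f (e := cnt ρ i) (by simp only [PLTL.delta]; omega),
        bv_congr _ g (e := cnt ρ i) (by simp only [PLTL.delta]; omega)] at this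
      rcases hstep i with ⟨h, hc⟩ | ⟨hc, h⟩
      · have := this.2 h
        rw [bv_congr _ (.rels f g) (e := cnt ρ i + 1) (by omega)] at this
        rw [hc]; exact this
      · have := this.1 (h _)
        rw [bv_congr _ (.rels f g) (e := cnt ρ i) (by omega)] at this
        rw [hc]; exact this
    · obtain ⟨M, hM⟩ := hunb (PLTL.rels f g).delta
      obtain ⟨i, hi, h⟩ := hA.2.1 f g (List.mem_cons_self) (max N M)
      have hd := hM i ((le_max_right _ _).trans hi)
      refine ⟨i, (le_max_left _ _).trans hi, ?_⟩
      rw [← hg]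
      rw [bv_congr _ (.rels f g) (e := cnt ρ i) (by omega),
        bv_congr _ g (e := cnt ρ i) (by simp only [PLTL.delta] at hd ⊢; omega)] at h
      exact h
  | since f g hf hg =>
    have hf := hf hI.1 (fun i => (hS i).1) (fun i => (hT i).1) ⟨fun a b h => hA.1 a b
      (List.mem_cons_of_mem _ (List.mem_append_left _ h)), fun a b h => hA.2.1 a b
      (List.mem_cons_of_mem _ (List.mem_append_left _ h)), hA.2.2⟩
    have hg := hg hI.2.1 (fun i => (hS i).2) (fun i => (hT i).2.1) ⟨fun a b h => hA.1 a b
      (List.mem_cons_of_mem _ (List.mem_append_right _ h)), fun a b h => hA.2.1 a b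
      (List.mem_cons_of_mem _ (List.mem_append_right _ h)), hA.2.2⟩
    refine SS_of_rec (F := ws α f) (G := ws α g) ?_ (fun i => ?_)
    · rw [← hg, h0]
      have := hI.2.2
      rw [val_eq _ _ (Nat.zero_le _)] at this
      exact this
    · have := (hT i).2.2 _ (min_le_right (cnt ρ i) _)
      rw [← hf, ← hg]
      rcases hstep i with ⟨h, hc⟩ | ⟨hc, h⟩
      · have := this.2 h
        rw [bv_congr _ (.since f g) (e := cnt ρ i + 1) (by omega),
          bv_congr _ f (e := cnt ρ i + 1) (by simp only [PLTL.delta]; omega),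
          bv_congr _ g (e := cnt ρ i + 1) (by simp only [PLTL.delta]; omega)] at this
        rw [hc]; exact this
      · have := this.1 (h _)
        rw [bv_congr _ f (e := cnt ρ i) (by simp only [PLTL.delta]; omega),
          bv_congr _ g (e := cnt ρ i) (by simp only [PLTL.delta]; omega)] at this
        rw [hc]; exact this
  | trig f g hf hg =>
    have hf := hf hI.1 (fun i => (hS i).1) (fun i => (hT i).1) ⟨fun a b h => hA.1 a b
      (List.mem_cons_of_mem _ (List.mem_append_left _ h)), fun a b h => hA.2.1 a b
      (List.mem_cons_of_mem _ (List.mem_append_left _ h)), hA.2.2⟩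
    have hg := hg hI.2.1 (fun i => (hS i).2) (fun i => (hT i).2.1) ⟨fun a b h => hA.1 a b
      (List.mem_cons_of_mem _ (List.mem_append_right _ h)), fun a b h => hA.2.1 a b
      (List.mem_cons_of_mem _ (List.mem_append_right _ h)), hA.2.2⟩
    refine TT_of_rec (F := ws α f) (G := ws α g) ?_ (fun i => ?_)
    · rw [← hg, h0]
      have := hI.2.2
      rw [val_eq _ _ (Nat.zero_le _)] at this
      exact this
    · have := (hT i).2.2 _ (min_le_right (cnt ρ i) _)
      rw [← hf, ← hg]
      rcases hstep i with ⟨h, hc⟩ | ⟨hc, h⟩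
      · have := this.2 h
        rw [bv_congr _ (.trig f g) (e := cnt ρ i + 1) (by omega),
          bv_congr _ f (e := cnt ρ i + 1) (by simp only [PLTL.delta]; omega),
          bv_congr _ g (e := cnt ρ i + 1) (by simp only [PLTL.delta]; omega)] at this
        rw [hc]; exact this
      · have := this.1 (h _)
        rw [bv_congr _ f (e := cnt ρ i) (by simp only [PLTL.delta]; omega),
          bv_congr _ g (e := cnt ρ i) (by simp only [PLTL.delta]; omega)] at this
        rw [hc]; exact this

theorem sound (ψ : PLTL AP) (α : ℕ → Set AP) (h : baLang ψ α) : wordSat α ψ := by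
  obtain ⟨ρ, ⟨⟨_, hi, hψ⟩, ht, ha⟩, hacc⟩ := h
  exact (sound_aux α ρ (fun i => (ht i).1.1) (fun i => (ht i).2.2.1) ha ψ hi
    (fun i => (ht i).1.2) (fun i => (ht i).2.2.2) hacc 0).1 hψ

end BMC

open BMC in
/-- Theorem: the Büchi automaton `B^ψ` obtained by virtual unrolling accepts
exactly the words satisfying `ψ`, and it is tight: every ultimately periodic
word `α = βγ^ω ∈ L(B^ψ)` has an accepting run of the same shape. -/
theorem tight_buchi_correct_and_tight {AP : Type} (ψ : PLTL AP) :
    (∀ α : ℕ → Set AP, baLang ψ α ↔ wordSat α ψ) ∧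
    (∀ (α : ℕ → Set AP) (b p : ℕ), 0 < p →
      (∀ i, b ≤ i → α (i + p) = α i) → baLang ψ α →
      ∃ ρ : ℕ → BASt AP, baRunOn ψ ρ α ∧ baAccepting ψ ρ ∧
        ∀ i, b ≤ i → ρ (i + p) = ρ i) := by
  exact ⟨fun α => ⟨sound ψ α, complete ψ α⟩,
    fun α b p hp hα h => tight ψ α b p hp hα (sound ψ α h)⟩
end

section
/- Given a finite Kripke structure M and a PLTL formula ψ in positive normal form, M has an initialised infinite path π with π ⊨ ψ if and only if there exists k ∈ ℕ such that the incremental PLTL eventuality encoding ⟦M,ψ,k⟧ = ⟦M⟧_k ∧ ⟦LoopConstraints⟧_k ∧ ⟦LastStateFormula⟧_k ∧ ⟦IncPLTL⟧_k ∧ ⟦ψ⟧^0_0 is propositionally satisfiable; in particular, if π ⊨_k ψ for some initialised path π of M then ⟦M,ψ,k⟧ is satisfiable. Equivalently, the incremental encoding is satisfiable for a bound k iff the (non-incremental) PLTL eventuality encoding is. -/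
namespace BMC

variable {AP S : Type}

/-- Model constraints `⟦M⟧_k = I(s_0) ∧ ⋀_{i=1}^k T(s_{i-1}, s_i)`. -/
def ModelC (M : Kripke S AP) (k : ℕ) (s : ℕ → S) : Prop :=
  M.I (s 0) ∧ ∀ i, 1 ≤ i → i ≤ k → M.T (s (i - 1)) (s i)

/-- Loop constraints `⟦LoopConstraints⟧_k`. -/
def LoopC (k : ℕ) (s : ℕ → S) (lsel inL : ℕ → Prop) (LE : Prop) : Prop :=
  ¬ lsel 0 ∧ ¬ inL 0 ∧
  (∀ i, 1 ≤ i → i ≤ k → (lsel i → s (i - 1) = s k)) ∧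
  (∀ i, 1 ≤ i → i ≤ k → (inL i ↔ (inL (i - 1) ∨ lsel i))) ∧
  (∀ i, 1 ≤ i → i ≤ k → (inL (i - 1) → ¬ lsel i)) ∧
  (LE ↔ inL k)

end BMC
namespace BMC

variable {AP S : Type}

/-- Lookup of the virtually unrolled formula variable `⟦φ⟧^d_i`, using the
convention `⟦φ⟧^d_i = ⟦φ⟧^{δ(φ)}_i` when `d > δ(φ)`. -/
def pV (v : PLTL AP → ℕ → ℕ → Prop) (φ : PLTL AP) (d i : ℕ) : Prop :=
  v φ (min d φ.delta) i

/-- `⟦LastStateFormula⟧_k` constraints for one subformula `φ` of the PLTL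
eventuality encoding. -/
def pLastC (k : ℕ) (lsel : ℕ → Prop) (LE : Prop)
    (v : PLTL AP → ℕ → ℕ → Prop) (φ : PLTL AP) : Prop :=
  ∀ d, d ≤ φ.delta →
    (¬ LE → ¬ v φ d (k + 1)) ∧
    (∀ i, 1 ≤ i → i ≤ k → lsel i → (v φ d (k + 1) ↔ pV v φ (d + 1) i))

/-- The constraints `⟦EventualityPLTL⟧_k` (together with the
`⟦LastStateFormula⟧_k` constraints) of the PLTL eventuality encoding,
generated for a formula and, recursively, all of its subformulas.
`v φ d i` is the formula variable `⟦φ⟧^d_i` and `aux φ i` the auxiliary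
variable `⟨⟨Fψ2⟩⟩^{δ(ψ2)}_i` (for until subformulas `φ = ψ1 U ψ2`)
resp. `⟨⟨Gψ2⟩⟩^{δ(ψ2)}_i` (for release subformulas). -/
def pevC (k : ℕ) (L : S → Set AP) (s : ℕ → S) (lsel inL : ℕ → Prop)
    (LE : Prop) (v : PLTL AP → ℕ → ℕ → Prop) (aux : PLTL AP → ℕ → Prop) :
    PLTL AP → Prop
  | .atom p =>
      (∀ i, i ≤ k → (v (.atom p) 0 i ↔ p ∈ L (s i))) ∧
      pLastC k lsel LE v (.atom p)
  | .natom p =>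
      (∀ i, i ≤ k → (v (.natom p) 0 i ↔ p ∉ L (s i))) ∧
      pLastC k lsel LE v (.natom p)
  | .conj f g =>
      pevC k L s lsel inL LE v aux f ∧ pevC k L s lsel inL LE v aux g ∧
      (∀ d, d ≤ (PLTL.conj f g).delta → ∀ i, i ≤ k →
        (v (.conj f g) d i ↔ (pV v f d i ∧ pV v g d i))) ∧
      pLastC k lsel LE v (.conj f g)
  | .disj f g =>
      pevC k L s lsel inL LE v aux f ∧ pevC k L s lsel inL LE v aux g ∧
      (∀ d, d ≤ (PLTL.disj f g).delta → ∀ i, i ≤ k →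
        (v (.disj f g) d i ↔ (pV v f d i ∨ pV v g d i))) ∧
      pLastC k lsel LE v (.disj f g)
  | .next f =>
      pevC k L s lsel inL LE v aux f ∧
      (∀ d, d ≤ (PLTL.next f).delta → ∀ i, i ≤ k →
        (v (.next f) d i ↔ pV v f d (i + 1))) ∧
      pLastC k lsel LE v (.next f)
  | .untl f g =>
      pevC k L s lsel inL LE v aux f ∧ pevC k L s lsel inL LE v aux g ∧
      (∀ d, d ≤ (PLTL.untl f g).delta → ∀ i, i ≤ k →
        (v (.untl f g) d i ↔
          (pV v g d i ∨ (pV v f d i ∧ v (.untl f g) d (i + 1))))) ∧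
      pLastC k lsel LE v (.untl f g) ∧
      (¬ aux (.untl f g) 0) ∧
      (∀ i, 1 ≤ i → i ≤ k →
        (aux (.untl f g) i ↔
          (aux (.untl f g) (i - 1) ∨ (inL i ∧ v g g.delta i)))) ∧
      (LE → v (.untl f g) (PLTL.untl f g).delta k → aux (.untl f g) k)
  | .rels f g =>
      pevC k L s lsel inL LE v aux f ∧ pevC k L s lsel inL LE v aux g ∧
      (∀ d, d ≤ (PLTL.rels f g).delta → ∀ i, i ≤ k →
        (v (.rels f g) d i ↔
          (pV v g d i ∧ (pV v f d i ∨ v (.rels f g) d (i + 1))))) ∧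
      pLastC k lsel LE v (.rels f g) ∧
      (aux (.rels f g) 0) ∧
      (∀ i, 1 ≤ i → i ≤ k →
        (aux (.rels f g) i ↔
          (aux (.rels f g) (i - 1) ∧ (¬ inL i ∨ v g g.delta i)))) ∧
      (LE → aux (.rels f g) k → v (.rels f g) (PLTL.rels f g).delta k)
  | .prev f =>
      pevC k L s lsel inL LE v aux f ∧
      (∀ d, d ≤ (PLTL.prev f).delta → ¬ v (.prev f) d 0) ∧
      (∀ i, 1 ≤ i → i ≤ k → (v (.prev f) 0 i ↔ pV v f 0 (i - 1))) ∧
      (∀ d, 1 ≤ d → d ≤ (PLTL.prev f).delta → ∀ i, 1 ≤ i → i ≤ k →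
        (v (.prev f) d i ↔
          ((lsel i ∧ pV v f (d - 1) k) ∨ (¬ lsel i ∧ pV v f d (i - 1))))) ∧
      pLastC k lsel LE v (.prev f)
  | .wprev f =>
      pevC k L s lsel inL LE v aux f ∧
      (∀ d, d ≤ (PLTL.wprev f).delta → v (.wprev f) d 0) ∧
      (∀ i, 1 ≤ i → i ≤ k → (v (.wprev f) 0 i ↔ pV v f 0 (i - 1))) ∧
      (∀ d, 1 ≤ d → d ≤ (PLTL.wprev f).delta → ∀ i, 1 ≤ i → i ≤ k →
        (v (.wprev f) d i ↔
          ((lsel i ∧ pV v f (d - 1) k) ∨ (¬ lsel i ∧ pV v f d (i - 1))))) ∧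
      pLastC k lsel LE v (.wprev f)
  | .since f g =>
      pevC k L s lsel inL LE v aux f ∧ pevC k L s lsel inL LE v aux g ∧
      (∀ d, d ≤ (PLTL.since f g).delta → (v (.since f g) d 0 ↔ pV v g d 0)) ∧
      (∀ i, 1 ≤ i → i ≤ k →
        (v (.since f g) 0 i ↔
          (pV v g 0 i ∨ (pV v f 0 i ∧ v (.since f g) 0 (i - 1))))) ∧
      (∀ d, 1 ≤ d → d ≤ (PLTL.since f g).delta → ∀ i, 1 ≤ i → i ≤ k →
        (v (.since f g) d i ↔
          (pV v g d i ∨ (pV v f d i ∧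
            ((lsel i ∧ v (.since f g) (d - 1) k) ∨
             (¬ lsel i ∧ v (.since f g) d (i - 1))))))) ∧
      pLastC k lsel LE v (.since f g)
  | .trig f g =>
      pevC k L s lsel inL LE v aux f ∧ pevC k L s lsel inL LE v aux g ∧
      (∀ d, d ≤ (PLTL.trig f g).delta → (v (.trig f g) d 0 ↔ pV v g d 0)) ∧
      (∀ i, 1 ≤ i → i ≤ k →
        (v (.trig f g) 0 i ↔
          (pV v g 0 i ∧ (pV v f 0 i ∨ v (.trig f g) 0 (i - 1))))) ∧
      (∀ d, 1 ≤ d → d ≤ (PLTL.trig f g).delta → ∀ i, 1 ≤ i → i ≤ k →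
        (v (.trig f g) d i ↔
          (pV v g d i ∧ (pV v f d i ∨
            ((lsel i ∧ v (.trig f g) (d - 1) k) ∨
             (¬ lsel i ∧ v (.trig f g) d (i - 1))))))) ∧
      pLastC k lsel LE v (.trig f g)

/-- Satisfiability of the PLTL eventuality encoding
`⟦M,ψ,k⟧ = ⟦M⟧_k ∧ ⟦LoopConstraints⟧_k ∧ ⟦LastStateFormula⟧_k ∧
⟦EventualityPLTL⟧_k ∧ ⟦ψ⟧^0_0`. -/
def PEvSat (M : Kripke S AP) (ψ : PLTL AP) (k : ℕ) : Prop :=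
  ∃ (s : ℕ → S) (lsel inL : ℕ → Prop) (LE : Prop)
    (v : PLTL AP → ℕ → ℕ → Prop) (aux : PLTL AP → ℕ → Prop),
    ModelC M k s ∧ LoopC k s lsel inL LE ∧
    pevC k M.L s lsel inL LE v aux ψ ∧ v ψ 0 0

end BMC
namespace BMC

variable {AP S : Type}

/-- Lookup of a proxy formula variable (at index `E` or `L`) with the
convention that unrollings beyond `δ(φ)` are identified with `δ(φ)`. -/
def pW (w : PLTL AP → ℕ → Prop) (φ : PLTL AP) (d : ℕ) : Prop :=
  w φ (min d φ.delta)

/-- Loop constraints of the incremental PLTL eventuality encoding, using the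
proxy state `sE`; the flag `dep` controls whether the `k`-dependent
constraints (`s_E = s_k` and `LoopExists ⇔ InLoop_k`) are included. -/
def incLoopC (dep : Bool) (k : ℕ) (s : ℕ → S) (sE : S)
    (lsel inL : ℕ → Prop) (LE : Prop) : Prop :=
  ¬ lsel 0 ∧ ¬ inL 0 ∧
  (∀ i, 1 ≤ i → i ≤ k → (lsel i → s (i - 1) = sE)) ∧
  (∀ i, 1 ≤ i → i ≤ k → (inL i ↔ (inL (i - 1) ∨ lsel i))) ∧
  (∀ i, 1 ≤ i → i ≤ k → (inL (i - 1) → ¬ lsel i)) ∧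
  (dep = true → (LE ↔ inL k)) ∧
  (dep = true → sE = s k)

/-- The `⟦LastStateFormula⟧_k` constraints of the incremental encoding for one
subformula `φ`, with proxy variables `⟦φ⟧^d_L` and `⟦φ⟧^d_E`; the flag `dep`
controls the `k`-dependent constraints `⟦φ⟧^d_E ⇔ ⟦φ⟧^d_k` and
`⟦φ⟧^d_{k+1} ⇔ ⟦φ⟧^{min(d+1,δ(φ))}_L`. -/
def incLastC (dep : Bool) (k : ℕ) (lsel : ℕ → Prop) (LE : Prop)
    (v : PLTL AP → ℕ → ℕ → Prop) (vE vL : PLTL AP → ℕ → Prop)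
    (φ : PLTL AP) : Prop :=
  ∀ d, d ≤ φ.delta →
    (¬ LE → ¬ vL φ d) ∧
    (∀ i, 1 ≤ i → i ≤ k → lsel i → (vL φ d ↔ v φ d i)) ∧
    (dep = true → (vE φ d ↔ v φ d k)) ∧
    (dep = true → (v φ d (k + 1) ↔ pW vL φ (d + 1)))

/-- The constraints `⟦IncPLTL⟧_k` (together with `⟦LastStateFormula⟧_k`) of
the incremental PLTL eventuality encoding, generated recursively for all
subformulas.  `v φ d i` are the formula variables, `vE`/`vL` the proxy
variables at the proxy indices `E` resp. `L`, `aux φ i` the auxiliary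
variables and `auxE φ` their proxies at index `E`; the flag `dep` controls
whether the `k`-dependent constraints are included. -/
def pincC (dep : Bool) (k : ℕ) (L : S → Set AP) (s : ℕ → S)
    (lsel inL : ℕ → Prop) (LE : Prop) (v : PLTL AP → ℕ → ℕ → Prop)
    (vE vL : PLTL AP → ℕ → Prop) (aux : PLTL AP → ℕ → Prop)
    (auxE : PLTL AP → Prop) : PLTL AP → Prop
  | .atom p =>
      (∀ i, i ≤ k → (v (.atom p) 0 i ↔ p ∈ L (s i))) ∧
      incLastC dep k lsel LE v vE vL (.atom p)
  | .natom p =>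
      (∀ i, i ≤ k → (v (.natom p) 0 i ↔ p ∉ L (s i))) ∧
      incLastC dep k lsel LE v vE vL (.natom p)
  | .conj f g =>
      pincC dep k L s lsel inL LE v vE vL aux auxE f ∧
      pincC dep k L s lsel inL LE v vE vL aux auxE g ∧
      (∀ d, d ≤ (PLTL.conj f g).delta → ∀ i, i ≤ k →
        (v (.conj f g) d i ↔ (pV v f d i ∧ pV v g d i))) ∧
      incLastC dep k lsel LE v vE vL (.conj f g)
  | .disj f g =>
      pincC dep k L s lsel inL LE v vE vL aux auxE f ∧
      pincC dep k L s lsel inL LE v vE vL aux auxE g ∧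
      (∀ d, d ≤ (PLTL.disj f g).delta → ∀ i, i ≤ k →
        (v (.disj f g) d i ↔ (pV v f d i ∨ pV v g d i))) ∧
      incLastC dep k lsel LE v vE vL (.disj f g)
  | .next f =>
      pincC dep k L s lsel inL LE v vE vL aux auxE f ∧
      (∀ d, d ≤ (PLTL.next f).delta → ∀ i, i ≤ k →
        (v (.next f) d i ↔ pV v f d (i + 1))) ∧
      incLastC dep k lsel LE v vE vL (.next f)
  | .untl f g =>
      pincC dep k L s lsel inL LE v vE vL aux auxE f ∧
      pincC dep k L s lsel inL LE v vE vL aux auxE g ∧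
      (∀ d, d ≤ (PLTL.untl f g).delta → ∀ i, i ≤ k →
        (v (.untl f g) d i ↔
          (pV v g d i ∨ (pV v f d i ∧ v (.untl f g) d (i + 1))))) ∧
      incLastC dep k lsel LE v vE vL (.untl f g) ∧
      (¬ aux (.untl f g) 0) ∧
      (∀ i, 1 ≤ i → i ≤ k →
        (aux (.untl f g) i ↔
          (aux (.untl f g) (i - 1) ∨ (inL i ∧ v g g.delta i)))) ∧
      (LE → vE (.untl f g) (PLTL.untl f g).delta → auxE (.untl f g)) ∧
      (dep = true → (auxE (.untl f g) ↔ aux (.untl f g) k))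
  | .rels f g =>
      pincC dep k L s lsel inL LE v vE vL aux auxE f ∧
      pincC dep k L s lsel inL LE v vE vL aux auxE g ∧
      (∀ d, d ≤ (PLTL.rels f g).delta → ∀ i, i ≤ k →
        (v (.rels f g) d i ↔
          (pV v g d i ∧ (pV v f d i ∨ v (.rels f g) d (i + 1))))) ∧
      incLastC dep k lsel LE v vE vL (.rels f g) ∧
      (aux (.rels f g) 0) ∧
      (∀ i, 1 ≤ i → i ≤ k →
        (aux (.rels f g) i ↔
          (aux (.rels f g) (i - 1) ∧ (¬ inL i ∨ v g g.delta i)))) ∧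
      (LE → auxE (.rels f g) → vE (.rels f g) (PLTL.rels f g).delta) ∧
      (dep = true → (auxE (.rels f g) ↔ aux (.rels f g) k))
  | .prev f =>
      pincC dep k L s lsel inL LE v vE vL aux auxE f ∧
      (∀ d, d ≤ (PLTL.prev f).delta → ¬ v (.prev f) d 0) ∧
      (∀ i, 1 ≤ i → i ≤ k → (v (.prev f) 0 i ↔ pV v f 0 (i - 1))) ∧
      (∀ d, 1 ≤ d → d ≤ (PLTL.prev f).delta → ∀ i, 1 ≤ i → i ≤ k →
        (v (.prev f) d i ↔
          ((lsel i ∧ pW vE f (d - 1)) ∨ (¬ lsel i ∧ pV v f d (i - 1))))) ∧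
      incLastC dep k lsel LE v vE vL (.prev f)
  | .wprev f =>
      pincC dep k L s lsel inL LE v vE vL aux auxE f ∧
      (∀ d, d ≤ (PLTL.wprev f).delta → v (.wprev f) d 0) ∧
      (∀ i, 1 ≤ i → i ≤ k → (v (.wprev f) 0 i ↔ pV v f 0 (i - 1))) ∧
      (∀ d, 1 ≤ d → d ≤ (PLTL.wprev f).delta → ∀ i, 1 ≤ i → i ≤ k →
        (v (.wprev f) d i ↔
          ((lsel i ∧ pW vE f (d - 1)) ∨ (¬ lsel i ∧ pV v f d (i - 1))))) ∧
      incLastC dep k lsel LE v vE vL (.wprev f)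
  | .since f g =>
      pincC dep k L s lsel inL LE v vE vL aux auxE f ∧
      pincC dep k L s lsel inL LE v vE vL aux auxE g ∧
      (∀ d, d ≤ (PLTL.since f g).delta → (v (.since f g) d 0 ↔ pV v g d 0)) ∧
      (∀ i, 1 ≤ i → i ≤ k →
        (v (.since f g) 0 i ↔
          (pV v g 0 i ∨ (pV v f 0 i ∧ v (.since f g) 0 (i - 1))))) ∧
      (∀ d, 1 ≤ d → d ≤ (PLTL.since f g).delta → ∀ i, 1 ≤ i → i ≤ k →
        (v (.since f g) d i ↔
          (pV v g d i ∨ (pV v f d i ∧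
            ((lsel i ∧ vE (.since f g) (d - 1)) ∨
             (¬ lsel i ∧ v (.since f g) d (i - 1))))))) ∧
      incLastC dep k lsel LE v vE vL (.since f g)
  | .trig f g =>
      pincC dep k L s lsel inL LE v vE vL aux auxE f ∧
      pincC dep k L s lsel inL LE v vE vL aux auxE g ∧
      (∀ d, d ≤ (PLTL.trig f g).delta → (v (.trig f g) d 0 ↔ pV v g d 0)) ∧
      (∀ i, 1 ≤ i → i ≤ k →
        (v (.trig f g) 0 i ↔
          (pV v g 0 i ∧ (pV v f 0 i ∨ v (.trig f g) 0 (i - 1))))) ∧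
      (∀ d, 1 ≤ d → d ≤ (PLTL.trig f g).delta → ∀ i, 1 ≤ i → i ≤ k →
        (v (.trig f g) d i ↔
          (pV v g d i ∧ (pV v f d i ∨
            ((lsel i ∧ vE (.trig f g) (d - 1)) ∨
             (¬ lsel i ∧ v (.trig f g) d (i - 1))))))) ∧
      incLastC dep k lsel LE v vE vL (.trig f g)

/-- Satisfiability of the incremental PLTL eventuality encoding
`⟦M,ψ,k⟧ = ⟦M⟧_k ∧ ⟦LoopConstraints⟧_k ∧ ⟦LastStateFormula⟧_k ∧
⟦IncPLTL⟧_k ∧ ⟦ψ⟧^0_0` (the witness formula). -/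
def IncSat (M : Kripke S AP) (ψ : PLTL AP) (k : ℕ) : Prop :=
  ∃ (s : ℕ → S) (sE : S) (lsel inL : ℕ → Prop) (LE : Prop)
    (v : PLTL AP → ℕ → ℕ → Prop) (vE vL : PLTL AP → ℕ → Prop)
    (aux : PLTL AP → ℕ → Prop) (auxE : PLTL AP → Prop),
    ModelC M k s ∧ incLoopC true k s sE lsel inL LE ∧
    pincC true k M.L s lsel inL LE v vE vL aux auxE ψ ∧ v ψ 0 0

end BMC
namespace BMC

section Helpers
variable {AP S : Type}

/- ### Equivalence of the two encodings -/

theorem pinc_last {dep k} {L : S → Set AP} {s lsel inL LE v vE vL aux auxE} {φ : PLTL AP}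
    (h : pincC dep k L s lsel inL LE v vE vL aux auxE φ) :
    incLastC dep k lsel LE v vE vL φ := by
  cases φ <;> first | exact h.2 | exact h.2.2 | exact h.2.2.2 | exact h.2.2.2.1 | exact h.2.2.2.2 | exact h.2.2.2.2.2

theorem pev_last {k} {L : S → Set AP} {s lsel inL LE v aux} {φ : PLTL AP}
    (h : pevC k L s lsel inL LE v aux φ) :
    pLastC k lsel LE v φ := by
  cases φ <;> first | exact h.2 | exact h.2.2 | exact h.2.2.2 | exact h.2.2.2.1 | exact h.2.2.2.2 | exact h.2.2.2.2.2

theorem inc_last_to {k} {lsel : ℕ → Prop} {LE : Prop} {v : PLTL AP → ℕ → ℕ → Prop} {vE vL}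
    {φ : PLTL AP} (h : incLastC true k lsel LE v vE vL φ) : pLastC k lsel LE v φ := by
  intro d hd
  have h1 := h d hd
  have h2 := h (min (d+1) φ.delta) (by omega)
  refine ⟨fun hL hv => h2.1 hL ((h1.2.2.2 rfl).1 hv), fun i hi hik hl => ?_⟩
  exact (h1.2.2.2 rfl).trans (h2.2.1 i hi hik hl)

theorem inc_last_pW {k} {lsel : ℕ → Prop} {LE : Prop} {v : PLTL AP → ℕ → ℕ → Prop} {vE vL}
    {φ : PLTL AP} (h : incLastC true k lsel LE v vE vL φ) (d : ℕ) :
    pW vE φ d ↔ pV v φ d k :=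
  (h (min d φ.delta) (by omega)).2.2.1 rfl

theorem inc_to_pev {k} {L : S → Set AP} {s lsel inL LE v vE vL aux auxE} (φ : PLTL AP)
    (h : pincC true k L s lsel inL LE v vE vL aux auxE φ) :
    pevC k L s lsel inL LE v aux φ := by
  have hl := inc_last_to (pinc_last h)
  have hE := pinc_last h
  induction φ with
  | atom p => exact ⟨h.1, hl⟩
  | natom p => exact ⟨h.1, hl⟩
  | conj f g ihf ihg =>
    exact ⟨ihf h.1 (inc_last_to (pinc_last h.1)) (pinc_last h.1),
      ihg h.2.1 (inc_last_to (pinc_last h.2.1)) (pinc_last h.2.1), h.2.2.1, hl⟩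
  | disj f g ihf ihg =>
    exact ⟨ihf h.1 (inc_last_to (pinc_last h.1)) (pinc_last h.1),
      ihg h.2.1 (inc_last_to (pinc_last h.2.1)) (pinc_last h.2.1), h.2.2.1, hl⟩
  | next f ihf =>
    exact ⟨ihf h.1 (inc_last_to (pinc_last h.1)) (pinc_last h.1), h.2.1, hl⟩
  | untl f g ihf ihg =>
    obtain ⟨h1, h2, h3, h4, h5, h6, h7, h8⟩ := h
    refine ⟨ihf h1 (inc_last_to (pinc_last h1)) (pinc_last h1),
      ihg h2 (inc_last_to (pinc_last h2)) (pinc_last h2), h3, hl, h5, h6, ?_⟩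
    intro a b
    exact (h8 rfl).1 (h7 a (((hE _ le_rfl).2.2.1 rfl).2 b))
  | rels f g ihf ihg =>
    obtain ⟨h1, h2, h3, h4, h5, h6, h7, h8⟩ := h
    refine ⟨ihf h1 (inc_last_to (pinc_last h1)) (pinc_last h1),
      ihg h2 (inc_last_to (pinc_last h2)) (pinc_last h2), h3, hl, h5, h6, ?_⟩
    intro a b
    exact ((hE _ le_rfl).2.2.1 rfl).1 (h7 a ((h8 rfl).2 b))
  | prev f ihf =>
    obtain ⟨h1, h2, h3, h4, h5⟩ := h
    refine ⟨ihf h1 (inc_last_to (pinc_last h1)) (pinc_last h1), h2, h3, ?_, hl⟩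
    intro d hd hd' i hi hi'
    rw [h4 d hd hd' i hi hi', inc_last_pW (pinc_last h1)]
  | wprev f ihf =>
    obtain ⟨h1, h2, h3, h4, h5⟩ := h
    refine ⟨ihf h1 (inc_last_to (pinc_last h1)) (pinc_last h1), h2, h3, ?_, hl⟩
    intro d hd hd' i hi hi'
    rw [h4 d hd hd' i hi hi', inc_last_pW (pinc_last h1)]
  | since f g ihf ihg =>
    obtain ⟨h1, h2, h3, h4, h5, h6⟩ := h
    refine ⟨ihf h1 (inc_last_to (pinc_last h1)) (pinc_last h1),
      ihg h2 (inc_last_to (pinc_last h2)) (pinc_last h2), h3, h4, ?_, hl⟩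
    intro d hd hd' i hi hi'
    rw [h5 d hd hd' i hi hi', (hE (d-1) (by omega)).2.2.1 rfl]
  | trig f g ihf ihg =>
    obtain ⟨h1, h2, h3, h4, h5, h6⟩ := h
    refine ⟨ihf h1 (inc_last_to (pinc_last h1)) (pinc_last h1),
      ihg h2 (inc_last_to (pinc_last h2)) (pinc_last h2), h3, h4, ?_, hl⟩
    intro d hd hd' i hi hi'
    rw [h5 d hd hd' i hi hi', (hE (d-1) (by omega)).2.2.1 rfl]

theorem loop_mono {k} {s : ℕ → S} {lsel inL : ℕ → Prop} {LE : Prop}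
    (h : LoopC k s lsel inL LE) (i j : ℕ) (hij : i ≤ j) (hj : j ≤ k) (hi : inL i) : inL j := by
  obtain ⟨h0, h1, h2, h3, h4, h5⟩ := h
  induction j, hij using Nat.le_induction with
  | base => exact hi
  | succ j hij ih =>
    exact (h3 (j+1) (by omega) hj).2 (Or.inl (ih (by omega)))

theorem loop_uniq {k} {s : ℕ → S} {lsel inL : ℕ → Prop} {LE : Prop}
    (h : LoopC k s lsel inL LE) (i j : ℕ) (hi : 1 ≤ i) (hj : 1 ≤ j) (hik : i ≤ k) (hjk : j ≤ k)
    (hli : lsel i) (hlj : lsel j) : i = j := by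
  by_contra hne
  have key : ∀ i j, 1 ≤ i → i < j → j ≤ k → lsel i → lsel j → False := by
    intro i j hi hij hj hli hlj
    have : inL i := (h.2.2.2.1 i hi (by omega)).2 (Or.inr hli)
    exact h.2.2.2.2.1 j (by omega) hj (loop_mono h i (j-1) (by omega) (by omega) this) hlj
  rcases Nat.lt_or_gt_of_ne hne with hlt | hlt
  · exact key i j hi hlt hjk hli hlj
  · exact key j i hj hlt hik hlj hli

theorem loop_ex {k} {s : ℕ → S} {lsel inL : ℕ → Prop} {LE : Prop}
    (h : LoopC k s lsel inL LE) (j : ℕ) (hj : j ≤ k) (hi : inL j) :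
    ∃ l, 1 ≤ l ∧ l ≤ j ∧ lsel l := by
  induction j with
  | zero => exact absurd hi h.2.1
  | succ j ih =>
    rcases (h.2.2.2.1 (j+1) (by omega) hj).1 hi with h' | h'
    · obtain ⟨l, a, b, c⟩ := ih (by omega) h'
      exact ⟨l, a, by omega, c⟩
    · exact ⟨j+1, by omega, le_rfl, h'⟩

theorem pev_to_inc {k} {L : S → Set AP} {s lsel inL LE v aux} (hL : LoopC k s lsel inL LE)
    (φ : PLTL AP) (h : pevC k L s lsel inL LE v aux φ) :
    pincC true k L s lsel inL LE v (fun φ d => v φ d k)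
      (fun φ d => LE ∧ ∃ i, 1 ≤ i ∧ i ≤ k ∧ lsel i ∧ v φ d i) aux (fun φ => aux φ k) φ := by
  have hE : ∀ φ : PLTL AP, pLastC k lsel LE v φ → incLastC true k lsel LE v (fun φ d => v φ d k)
      (fun φ d => LE ∧ ∃ i, 1 ≤ i ∧ i ≤ k ∧ lsel i ∧ v φ d i) φ := by
    intro φ hφ d hd
    refine ⟨fun a b => a b.1, ?_, fun _ => Iff.rfl, fun _ => ?_⟩
    · intro i hi hik hl
      constructor
      · rintro ⟨_, j, hj, hjk, hlj, hv⟩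
        rwa [loop_uniq hL i j hi hj hik hjk hl hlj]
      · intro hv
        refine ⟨hL.2.2.2.2.2.2 (loop_mono hL i k hik le_rfl ?_), i, hi, hik, hl, hv⟩
        exact (hL.2.2.2.1 i hi hik).2 (Or.inr hl)
    · have h1 := hφ d hd
      constructor
      · intro hv
        have hLE : LE := by by_contra hc; exact h1.1 hc hv
        obtain ⟨l, a, b, c⟩ := loop_ex hL k le_rfl (hL.2.2.2.2.2.1 hLE)
        exact ⟨hLE, l, a, b, c, (h1.2 l a b c).1 hv⟩
      · rintro ⟨hLE, l, a, b, c, hv⟩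
        exact (h1.2 l a b c).2 hv
  have hl := hE _ (pev_last h)
  induction φ with
  | atom p => exact ⟨h.1, hl⟩
  | natom p => exact ⟨h.1, hl⟩
  | conj f g ihf ihg =>
    exact ⟨ihf h.1 (hE _ (pev_last h.1)), ihg h.2.1 (hE _ (pev_last h.2.1)), h.2.2.1, hl⟩
  | disj f g ihf ihg =>
    exact ⟨ihf h.1 (hE _ (pev_last h.1)), ihg h.2.1 (hE _ (pev_last h.2.1)), h.2.2.1, hl⟩
  | next f ihf =>
    exact ⟨ihf h.1 (hE _ (pev_last h.1)), h.2.1, hl⟩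
  | untl f g ihf ihg =>
    obtain ⟨h1, h2, h3, h4, h5, h6, h7⟩ := h
    exact ⟨ihf h1 (hE _ (pev_last h1)), ihg h2 (hE _ (pev_last h2)), h3, hl, h5, h6, h7,
      fun _ => Iff.rfl⟩
  | rels f g ihf ihg =>
    obtain ⟨h1, h2, h3, h4, h5, h6, h7⟩ := h
    exact ⟨ihf h1 (hE _ (pev_last h1)), ihg h2 (hE _ (pev_last h2)), h3, hl, h5, h6, h7,
      fun _ => Iff.rfl⟩
  | prev f ihf =>
    obtain ⟨h1, h2, h3, h4, h5⟩ := h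
    exact ⟨ihf h1 (hE _ (pev_last h1)), h2, h3, h4, hl⟩
  | wprev f ihf =>
    obtain ⟨h1, h2, h3, h4, h5⟩ := h
    exact ⟨ihf h1 (hE _ (pev_last h1)), h2, h3, h4, hl⟩
  | since f g ihf ihg =>
    obtain ⟨h1, h2, h3, h4, h5, h6⟩ := h
    exact ⟨ihf h1 (hE _ (pev_last h1)), ihg h2 (hE _ (pev_last h2)), h3, h4, h5, hl⟩
  | trig f g ihf ihg =>
    obtain ⟨h1, h2, h3, h4, h5, h6⟩ := h
    exact ⟨ihf h1 (hE _ (pev_last h1)), ihg h2 (hE _ (pev_last h2)), h3, h4, h5, hl⟩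

theorem inc_iff_pev (M : Kripke S AP) (ψ : PLTL AP) (k : ℕ) : IncSat M ψ k ↔ PEvSat M ψ k := by
  constructor
  · rintro ⟨s, sE, lsel, inL, LE, v, vE, vL, aux, auxE, hM, hL, hp, hv⟩
    obtain ⟨a, b, c, d, e, f, g⟩ := hL
    have g := g rfl
    subst g
    exact ⟨s, lsel, inL, LE, v, aux, hM, ⟨a, b, c, d, e, f rfl⟩, inc_to_pev ψ hp, hv⟩
  · rintro ⟨s, lsel, inL, LE, v, aux, hM, hL, hp, hv⟩
    refine ⟨s, s k, lsel, inL, LE, v, _, _, aux, _, hM, ?_, pev_to_inc hL ψ hp, hv⟩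
    obtain ⟨a, b, c, d, e, f⟩ := hL
    exact ⟨a, b, c, d, e, fun _ => f, fun _ => rfl⟩

/- ### Fixpoint characterisations of the temporal operators -/

theorem U_char (A B C : ℕ → Prop) (step : ∀ t, C t ↔ (B t ∨ (A t ∧ C (t+1))))
    (fair : ∀ t, (∀ j, t ≤ j → C j) → (∀ j, t ≤ j → ¬ B j) → False) (t : ℕ) :
    C t ↔ ∃ j, t ≤ j ∧ B j ∧ ∀ n, t ≤ n → n < j → A n := by
  classical
  constructor
  · intro hC
    by_cases hB : ∃ j, t ≤ j ∧ B j
    · refine ⟨Nat.find hB, (Nat.find_spec hB).1, (Nat.find_spec hB).2, ?_⟩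
      have key : ∀ n, t ≤ n → n ≤ Nat.find hB → C n := by
        intro n hn
        induction n, hn using Nat.le_induction with
        | base => exact fun _ => hC
        | succ n hn ih =>
          intro hlt
          have h1 := (step n).1 (ih (by omega))
          have h2 := Nat.find_min hB (m := n) (by omega)
          tauto
      intro n hn hlt
      have h1 := (step n).1 (key n hn (by omega))
      have h2 := Nat.find_min hB hlt
      tauto
    · exfalso
      push Not at hB
      refine fair t ?_ hB
      intro n hn
      induction n, hn using Nat.le_induction with
      | base => exact hC
      | succ n hn ih =>
        have h1 := (step n).1 ih
        have h2 := hB n hn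
        tauto
  · rintro ⟨j, hj, hB, hA⟩
    have key : ∀ m n, n + m = j → t ≤ n → C n := by
      intro m
      induction m with
      | zero => intro n hn _; rw [step]; left; rwa [← (by omega : j = n)]
      | succ m ih =>
        intro n hn ht
        rw [step]
        exact Or.inr ⟨hA n ht (by omega), ih (n+1) (by omega) (by omega)⟩
    exact key (j - t) t (by omega) le_rfl

theorem R_char (A B C : ℕ → Prop) (step : ∀ t, C t ↔ (B t ∧ (A t ∨ C (t+1))))
    (fair : ∀ t, (∀ j, t ≤ j → ¬ C j) → (∀ j, t ≤ j → B j) → False) (t : ℕ) :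
    C t ↔ ∀ j, t ≤ j → (B j ∨ ∃ n, t ≤ n ∧ n < j ∧ A n) := by
  have h := U_char (fun n => ¬ A n) (fun n => ¬ B n) (fun n => ¬ C n)
    (fun t => by have := step t; tauto) (fun t h1 h2 => fair t h1 (by simpa using h2)) t
  rw [← not_iff_not, h]
  push Not
  rfl

theorem S_char (A B C : ℕ → Prop) (h0 : C 0 ↔ B 0)
    (step : ∀ t, C (t+1) ↔ (B (t+1) ∨ (A (t+1) ∧ C t))) (t : ℕ) :
    C t ↔ ∃ j, j ≤ t ∧ B j ∧ ∀ n, j < n → n ≤ t → A n := by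
  induction t with
  | zero =>
    rw [h0]
    constructor
    · exact fun h => ⟨0, le_rfl, h, fun n _ _ => by omega⟩
    · rintro ⟨j, hj, hB, -⟩
      rwa [(by omega : j = 0)] at hB
  | succ t ih =>
    rw [step, ih]
    constructor
    · rintro (h | ⟨h, j, hj, hB, hA⟩)
      · exact ⟨t+1, le_rfl, h, fun n _ _ => by omega⟩
      · refine ⟨j, by omega, hB, fun n h1 h2 => ?_⟩
        rcases Nat.lt_or_ge t n with h3 | h3
        · rwa [(by omega : n = t+1)]
        · exact hA n h1 h3
    · rintro ⟨j, hj, hB, hA⟩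
      rcases Nat.lt_or_ge t j with h3 | h3
      · left; rwa [(by omega : t+1 = j)]
      · exact Or.inr ⟨hA _ (by omega) le_rfl, j, h3, hB, fun n h1 h2 => hA n h1 (by omega)⟩

theorem T_char (A B C : ℕ → Prop) (h0 : C 0 ↔ B 0)
    (step : ∀ t, C (t+1) ↔ (B (t+1) ∧ (A (t+1) ∨ C t))) (t : ℕ) :
    C t ↔ ∀ j, j ≤ t → (B j ∨ ∃ n, j < n ∧ n ≤ t ∧ A n) := by
  have h := S_char (fun n => ¬ A n) (fun n => ¬ B n) (fun n => ¬ C n)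
    (by tauto) (fun t => by have := step t; tauto) t
  rw [← not_iff_not, h]
  push Not
  rfl

theorem U_step (A B : ℕ → Prop) (t : ℕ) :
    (∃ j, t ≤ j ∧ B j ∧ ∀ n, t ≤ n → n < j → A n) ↔
    (B t ∨ (A t ∧ ∃ j, t+1 ≤ j ∧ B j ∧ ∀ n, t+1 ≤ n → n < j → A n)) := by
  constructor
  · rintro ⟨j, hj, hB, hA⟩
    rcases Nat.eq_or_lt_of_le hj with h | h
    · left; rwa [h]
    · exact Or.inr ⟨hA t le_rfl h, j, h, hB, fun n h1 h2 => hA n (by omega) h2⟩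
  · rintro (h | ⟨h, j, hj, hB, hA⟩)
    · exact ⟨t, le_rfl, h, fun n _ _ => by omega⟩
    · refine ⟨j, by omega, hB, fun n h1 h2 => ?_⟩
      rcases Nat.eq_or_lt_of_le h1 with h3 | h3
      · rwa [← h3]
      · exact hA n h3 h2

theorem R_step (A B : ℕ → Prop) (t : ℕ) :
    (∀ j, t ≤ j → (B j ∨ ∃ n, t ≤ n ∧ n < j ∧ A n)) ↔
    (B t ∧ (A t ∨ ∀ j, t+1 ≤ j → (B j ∨ ∃ n, t+1 ≤ n ∧ n < j ∧ A n))) := by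
  have h := U_step (fun n => ¬ A n) (fun n => ¬ B n) t
  rw [← not_iff_not]
  push Not
  rw [← imp_iff_not_or] at h
  exact h

theorem S_step (A B : ℕ → Prop) :
    ((∃ j, j ≤ 0 ∧ B j ∧ ∀ n, j < n → n ≤ 0 → A n) ↔ B 0) ∧
    ∀ t, (∃ j, j ≤ t+1 ∧ B j ∧ ∀ n, j < n → n ≤ t+1 → A n) ↔
    (B (t+1) ∨ (A (t+1) ∧ ∃ j, j ≤ t ∧ B j ∧ ∀ n, j < n → n ≤ t → A n)) := by
  let C : ℕ → Prop := fun t => Nat.rec (B 0) (fun t c => B (t+1) ∨ (A (t+1) ∧ c)) t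
  have h := S_char A B C Iff.rfl (fun t => Iff.rfl)
  refine ⟨(h 0).symm, fun t => ?_⟩
  rw [← h t, ← h (t+1)]

theorem T_step (A B : ℕ → Prop) :
    ((∀ j, j ≤ 0 → (B j ∨ ∃ n, j < n ∧ n ≤ 0 ∧ A n)) ↔ B 0) ∧
    ∀ t, (∀ j, j ≤ t+1 → (B j ∨ ∃ n, j < n ∧ n ≤ t+1 ∧ A n)) ↔
    (B (t+1) ∧ (A (t+1) ∨ ∀ j, j ≤ t → (B j ∨ ∃ n, j < n ∧ n ≤ t ∧ A n))) := by
  let C : ℕ → Prop := fun t => Nat.rec (B 0) (fun t c => B (t+1) ∧ (A (t+1) ∨ c)) t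
  have h := T_char A B C Iff.rfl (fun t => Iff.rfl)
  refine ⟨(h 0).symm, fun t => ?_⟩
  rw [← h t, ← h (t+1)]


/- ### The no-loop case -/

theorem BU_step (A B : ℕ → Prop) (k t : ℕ) (ht : t ≤ k) :
    (∃ j, t ≤ j ∧ j ≤ k ∧ B j ∧ ∀ n, t ≤ n → n < j → A n) ↔
    (B t ∨ (A t ∧ (t+1 ≤ k ∧ ∃ j, t+1 ≤ j ∧ j ≤ k ∧ B j ∧ ∀ n, t+1 ≤ n → n < j → A n))) := by
  have h := U_step A (fun j => j ≤ k ∧ B j) t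
  simp only [and_assoc] at h
  rw [h]
  constructor
  · rintro (h | ⟨h, j, hj, hk, h'⟩)
    · exact Or.inl h.2
    · exact Or.inr ⟨h, by omega, j, hj, hk, h'⟩
  · rintro (h | ⟨h, -, h'⟩)
    · exact Or.inl ⟨ht, h⟩
    · exact Or.inr ⟨h, h'⟩

theorem BR_step (A B : ℕ → Prop) (k t : ℕ) (ht : t ≤ k) :
    (∃ j, t ≤ j ∧ j ≤ k ∧ A j ∧ ∀ n, t ≤ n → n ≤ j → B n) ↔
    (B t ∧ (A t ∨ (t+1 ≤ k ∧ ∃ j, t+1 ≤ j ∧ j ≤ k ∧ A j ∧ ∀ n, t+1 ≤ n → n ≤ j → B n))) := by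
  constructor
  · rintro ⟨j, hj, hk, hA, hB⟩
    refine ⟨hB t le_rfl hj, ?_⟩
    rcases Nat.eq_or_lt_of_le hj with h | h
    · left; rwa [h]
    · exact Or.inr ⟨by omega, j, h, hk, hA, fun n h1 h2 => hB n (by omega) h2⟩
  · rintro ⟨hB, h | ⟨h, j, hj, hk, hA, hB'⟩⟩
    · exact ⟨t, le_rfl, ht, h, fun n _ _ => by rwa [(by omega : n = t)]⟩
    · refine ⟨j, by omega, hk, hA, fun n h1 h2 => ?_⟩
      rcases Nat.eq_or_lt_of_le h1 with h3 | h3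
      · rwa [← h3]
      · exact hB' n h3 h2

theorem nl_complete (L : S → Set AP) (π : ℕ → S) (k : ℕ) (φ : PLTL AP) :
    pevC k L π (fun _ => False) (fun _ => False) False
      (fun φ _ i => i ≤ k ∧ PLTL.satNL L π k φ i)
      (fun φ _ => match φ with | .rels _ _ => True | _ => False) φ := by
  have hl : ∀ φ : PLTL AP, pLastC k (fun _ => False) False
      (fun φ _ i => i ≤ k ∧ PLTL.satNL L π k φ i) φ := by
    intro φ d hd
    refine ⟨fun _ h => by omega, fun i _ _ h => h.elim⟩
  induction φ with
  | atom p => exact ⟨fun i hi => by simp [hi, PLTL.satNL], hl _⟩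
  | natom p => exact ⟨fun i hi => by simp [hi, PLTL.satNL], hl _⟩
  | conj f g ihf ihg =>
    exact ⟨ihf, ihg, fun d _ i hi => by simp [hi, PLTL.satNL, pV], hl _⟩
  | disj f g ihf ihg =>
    exact ⟨ihf, ihg, fun d _ i hi => by simp [hi, PLTL.satNL, pV], hl _⟩
  | next f ihf =>
    refine ⟨ihf, fun d _ i hi => ?_, hl _⟩
    simp [hi, PLTL.satNL, pV]
  | untl f g ihf ihg =>
    refine ⟨ihf, ihg, fun d _ i hi => ?_, hl _, id, fun i _ _ => by simp, fun h => h.elim⟩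
    simp only [PLTL.satNL, pV, hi, true_and]
    exact BU_step _ _ k i hi
  | rels f g ihf ihg =>
    refine ⟨ihf, ihg, fun d _ i hi => ?_, hl _, trivial, fun i _ _ => by simp, fun h => h.elim⟩
    simp only [PLTL.satNL, pV, hi, true_and]
    exact BR_step _ _ k i hi
  | prev f ihf =>
    refine ⟨ihf, fun d _ => by simp [PLTL.satNL], fun i h1 h2 => ?_, fun d _ _ i h1 h2 => ?_, hl _⟩
    · simp only [PLTL.satNL, pV]
      have : i - 1 ≤ k := by omega
      simp [h2, this]; omega
    · simp only [PLTL.satNL, pV]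
      have : i - 1 ≤ k := by omega
      simp [h2, this]; omega
  | wprev f ihf =>
    refine ⟨ihf, fun d _ => by simp [PLTL.satNL], fun i h1 h2 => ?_, fun d _ _ i h1 h2 => ?_, hl _⟩
    · simp only [PLTL.satNL, pV]
      have : i - 1 ≤ k := by omega
      have h3 : i ≠ 0 := by omega
      simp [h2, this, h3]
    · simp only [PLTL.satNL, pV]
      have : i - 1 ≤ k := by omega
      have h3 : i ≠ 0 := by omega
      simp [h2, this, h3]
  | since f g ihf ihg =>
    have key : ∀ i, 1 ≤ i → i ≤ k → ((i ≤ k ∧ PLTL.satNL L π k (.since f g) i) ↔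
        ((i ≤ k ∧ PLTL.satNL L π k g i) ∨ ((i ≤ k ∧ PLTL.satNL L π k f i) ∧
          (i - 1 ≤ k ∧ PLTL.satNL L π k (.since f g) (i-1))))) := by
      intro i h1 h2
      obtain ⟨i, rfl⟩ : ∃ m, i = m + 1 := ⟨i-1, by omega⟩
      have : i ≤ k := by omega
      simp only [h2, true_and, Nat.add_sub_cancel, this]
      exact (S_step _ _).2 i
    refine ⟨ihf, ihg, fun d _ => ?_, fun i h1 h2 => key i h1 h2, fun d _ _ i h1 h2 => ?_, hl _⟩
    · simp only [pV, Nat.zero_le, true_and]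
      exact (S_step _ _).1
    · simp only [false_and, false_or, not_false_iff, true_and]
      exact key i h1 h2
  | trig f g ihf ihg =>
    have key : ∀ i, 1 ≤ i → i ≤ k → ((i ≤ k ∧ PLTL.satNL L π k (.trig f g) i) ↔
        ((i ≤ k ∧ PLTL.satNL L π k g i) ∧ ((i ≤ k ∧ PLTL.satNL L π k f i) ∨
          (i - 1 ≤ k ∧ PLTL.satNL L π k (.trig f g) (i-1))))) := by
      intro i h1 h2
      obtain ⟨i, rfl⟩ : ∃ m, i = m + 1 := ⟨i-1, by omega⟩
      have : i ≤ k := by omega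
      simp only [h2, true_and, Nat.add_sub_cancel, this]
      exact (T_step _ _).2 i
    refine ⟨ihf, ihg, fun d _ => ?_, fun i h1 h2 => key i h1 h2, fun d _ _ i h1 h2 => ?_, hl _⟩
    · simp only [pV, Nat.zero_le, true_and]
      exact (T_step _ _).1
    · simp only [false_and, false_or, not_false_iff, true_and]
      exact key i h1 h2

theorem sat_untl (L : S → Set AP) (π : ℕ → S) (f g : PLTL AP) (t : ℕ) :
    PLTL.sat L π (.untl f g) t ↔
      (PLTL.sat L π g t ∨ (PLTL.sat L π f t ∧ PLTL.sat L π (.untl f g) (t+1))) := U_step _ _ t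

theorem sat_rels (L : S → Set AP) (π : ℕ → S) (f g : PLTL AP) (t : ℕ) :
    PLTL.sat L π (.rels f g) t ↔
      (PLTL.sat L π g t ∧ (PLTL.sat L π f t ∨ PLTL.sat L π (.rels f g) (t+1))) := R_step _ _ t

theorem sat_since0 (L : S → Set AP) (π : ℕ → S) (f g : PLTL AP) :
    PLTL.sat L π (.since f g) 0 ↔ PLTL.sat L π g 0 := (S_step _ _).1

theorem sat_since (L : S → Set AP) (π : ℕ → S) (f g : PLTL AP) (t : ℕ) :
    PLTL.sat L π (.since f g) (t+1) ↔
      (PLTL.sat L π g (t+1) ∨ (PLTL.sat L π f (t+1) ∧ PLTL.sat L π (.since f g) t)) :=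
  (S_step _ _).2 t

theorem sat_trig0 (L : S → Set AP) (π : ℕ → S) (f g : PLTL AP) :
    PLTL.sat L π (.trig f g) 0 ↔ PLTL.sat L π g 0 := (T_step _ _).1

theorem sat_trig (L : S → Set AP) (π : ℕ → S) (f g : PLTL AP) (t : ℕ) :
    PLTL.sat L π (.trig f g) (t+1) ↔
      (PLTL.sat L π g (t+1) ∧ (PLTL.sat L π f (t+1) ∨ PLTL.sat L π (.trig f g) t)) :=
  (T_step _ _).2 t

theorem nl_sound {k} {L : S → Set AP} {s : ℕ → S} {lsel inL LE v aux} (hLE : ¬ LE)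
    (π : ℕ → S) (hπ : ∀ i, i ≤ k → π i = s i) (φ : PLTL AP)
    (h : pevC k L s lsel inL LE v aux φ) :
    ∀ i, i ≤ k → v φ 0 i → PLTL.sat L π φ i := by
  have hl : ∀ φ : PLTL AP, pLastC k lsel LE v φ → ∀ i, k < i → i ≤ k + 1 → ¬ v φ 0 i := by
    intro φ hφ i h1 h2
    rw [(by omega : i = k+1)]
    exact (hφ 0 (by omega)).1 hLE
  have p0 : ∀ (φ : PLTL AP) i, pV v φ 0 i = v φ 0 i := by
    intro φ i; simp [pV]
  induction φ with
  | atom p => intro i hi hv; rw [h.1 i hi] at hv; simpa [PLTL.sat, hπ i hi] using hv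
  | natom p => intro i hi hv; rw [h.1 i hi] at hv; simpa [PLTL.sat, hπ i hi] using hv
  | conj f g ihf ihg =>
    intro i hi hv
    rw [h.2.2.1 0 (by omega) i hi, p0, p0] at hv
    exact ⟨ihf h.1 i hi hv.1, ihg h.2.1 i hi hv.2⟩
  | disj f g ihf ihg =>
    intro i hi hv
    rw [h.2.2.1 0 (by omega) i hi, p0, p0] at hv
    exact hv.imp (ihf h.1 i hi) (ihg h.2.1 i hi)
  | next f ihf =>
    intro i hi hv
    rw [h.2.1 0 (by omega) i hi, p0] at hv
    have : i + 1 ≤ k := by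
      by_contra hc
      exact hl f (pev_last h.1) (i+1) (by omega) (by omega) hv
    exact ihf h.1 _ this hv
  | untl f g ihf ihg =>
    have key : ∀ m i, i + m = k + 1 → v (.untl f g) 0 i → PLTL.sat L π (.untl f g) i := by
      intro m
      induction m with
      | zero => intro i hi hv; exact (hl _ (pev_last h) i (by omega) (by omega) hv).elim
      | succ m ih =>
        intro i hi hv
        rw [h.2.2.1 0 (by omega) i (by omega), p0, p0] at hv
        rw [sat_untl]
        exact hv.imp (ihg h.2.1 i (by omega))
          (fun hv => ⟨ihf h.1 i (by omega) hv.1, ih (i+1) (by omega) hv.2⟩)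
    exact fun i hi => key (k + 1 - i) i (by omega)
  | rels f g ihf ihg =>
    have key : ∀ m i, i + m = k + 1 → v (.rels f g) 0 i → PLTL.sat L π (.rels f g) i := by
      intro m
      induction m with
      | zero => intro i hi hv; exact (hl _ (pev_last h) i (by omega) (by omega) hv).elim
      | succ m ih =>
        intro i hi hv
        rw [h.2.2.1 0 (by omega) i (by omega), p0, p0] at hv
        rw [sat_rels]
        exact ⟨ihg h.2.1 i (by omega) hv.1,
          hv.2.imp (ihf h.1 i (by omega)) (ih (i+1) (by omega))⟩
    exact fun i hi => key (k + 1 - i) i (by omega)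
  | prev f ihf =>
    intro i hi hv
    rcases Nat.eq_zero_or_pos i with h0 | h0
    · subst h0; exact (h.2.1 0 (by omega) hv).elim
    · rw [h.2.2.1 i h0 hi, p0] at hv
      exact ⟨h0, ihf h.1 _ (by omega) hv⟩
  | wprev f ihf =>
    intro i hi hv
    rcases Nat.eq_zero_or_pos i with h0 | h0
    · exact Or.inl h0
    · rw [h.2.2.1 i h0 hi, p0] at hv
      exact Or.inr (ihf h.1 _ (by omega) hv)
  | since f g ihf ihg =>
    intro i
    induction i with
    | zero =>
      intro hi hv
      rw [h.2.2.1 0 (by omega), p0] at hv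
      rw [sat_since0]; exact ihg h.2.1 _ hi hv
    | succ i ih =>
      intro hi hv
      rw [h.2.2.2.1 (i+1) (by omega) hi, p0, p0] at hv
      rw [sat_since]
      exact hv.imp (ihg h.2.1 _ hi) (fun hv => ⟨ihf h.1 _ hi hv.1, ih (by omega) hv.2⟩)
  | trig f g ihf ihg =>
    intro i
    induction i with
    | zero =>
      intro hi hv
      rw [h.2.2.1 0 (by omega), p0] at hv
      rw [sat_trig0]; exact ihg h.2.1 _ hi hv
    | succ i ih =>
      intro hi hv
      rw [h.2.2.2.1 (i+1) (by omega) hi, p0, p0] at hv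
      rw [sat_trig]
      exact ⟨ihg h.2.1 _ hi hv.1, hv.2.imp (ihf h.1 _ hi) (ih (by omega))⟩

theorem nl_path (M : Kripke S AP) (hTot : M.Total) (k : ℕ) (s : ℕ → S) (h : ModelC M k s) :
    ∃ π, M.InitPath π ∧ ∀ i, i ≤ k → π i = s i := by
  choose nx hnx using hTot
  let π : ℕ → S := fun t => Nat.rec (s 0) (fun t c => if t + 1 ≤ k then s (t+1) else nx c) t
  have hs : ∀ t, π (t+1) = if t + 1 ≤ k then s (t+1) else nx (π t) := fun t => rfl
  have h1 : ∀ i, i ≤ k → π i = s i := by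
    intro i hi
    cases i with
    | zero => rfl
    | succ i => rw [hs, if_pos hi]
  refine ⟨π, ⟨h.1, fun i => ?_⟩, h1⟩
  by_cases hi : i + 1 ≤ k
  · rw [h1 i (by omega), h1 (i+1) hi]
    exact h.2 (i+1) (by omega) hi
  · rw [hs, if_neg hi]; exact hnx _


/- ### The unrolling graph of a (k,l)-loop -/

def sc (k l : ℕ) (n : ℕ × ℕ) : ℕ × ℕ := if n.2 = k then (n.1 + 1, l) else (n.1, n.2 + 1)

def hh (k l : ℕ) : ℕ → ℕ × ℕ
  | 0 => (0, 0)
  | t + 1 => sc k l (hh k l t)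

theorem hh_inv {k l : ℕ} (hk : l ≤ k) (t : ℕ) :
    (hh k l t).2 ≤ k ∧ ((hh k l t).1 = 0 ∨ l ≤ (hh k l t).2) ∧
      t = (hh k l t).2 + (hh k l t).1 * (k + 1 - l) := by
  induction t with
  | zero => simp [hh]
  | succ t ih =>
    obtain ⟨h1, h2, h3⟩ := ih
    rw [hh, sc]
    split_ifs with h
    · refine ⟨hk, Or.inr le_rfl, ?_⟩
      simp only [add_mul]
      omega
    · refine ⟨by simp only; omega, by simp only; omega, by simp only; omega⟩

theorem hh_small {k l : ℕ} (t : ℕ) (ht : t ≤ k) : hh k l t = (0, t) := by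
  induction t with
  | zero => rfl
  | succ t ih =>
    rw [hh, ih (by omega), sc, if_neg (by simp only; omega)]

theorem hh_add {k l : ℕ} (t d i j : ℕ) (h : hh k l t = (d, i)) (hj : i + j ≤ k) :
    hh k l (t + j) = (d, i + j) := by
  induction j with
  | zero => exact h
  | succ j ih =>
    rw [← add_assoc, hh, ih (by omega), sc, if_neg (by simp only; omega)]
    rfl

theorem hh_loop {k l : ℕ} (hk : l ≤ k) (d i : ℕ) (h1 : l ≤ i) (h2 : i ≤ k) :
    hh k l (i + d * (k + 1 - l)) = (d, i) := by
  induction d generalizing i with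
  | zero => simp [hh_small i h2]
  | succ d ih =>
    have h := ih k hk le_rfl
    have h3 : hh k l (k + d * (k + 1 - l) + 1) = (d+1, l) := by rw [hh, h, sc, if_pos rfl]
    have h4 := hh_add _ _ _ (i - l) h3 (by omega)
    rw [(by omega : l + (i - l) = i)] at h4
    rw [← h4, add_mul]
    congr 1
    omega

theorem hh_visit {k l : ℕ} (hk : l ≤ k) (i : ℕ) (h1 : l ≤ i) (h2 : i ≤ k) (t D : ℕ) :
    ∃ j d, t ≤ j ∧ D ≤ d ∧ hh k l j = (d, i) := by
  refine ⟨_, D + t, ?_, by omega, hh_loop hk (D+t) i h1 h2⟩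
  have : (D + t) * 1 ≤ (D + t) * (k + 1 - l) := Nat.mul_le_mul_left _ (by omega)
  omega

theorem idem (k l : ℕ) (hk : l ≤ k) (F : ℕ → Prop → Prop)
    (mono : ∀ i (p q : Prop), (p → q) → F i p → F i q) (X Y : ℕ → Prop) (x : Prop)
    (hX : X l ↔ F l x) (hXs : ∀ i, l ≤ i → i < k → (X (i+1) ↔ F (i+1) (X i)))
    (hY : Y l ↔ F l (X k)) (hYs : ∀ i, l ≤ i → i < k → (Y (i+1) ↔ F (i+1) (Y i))) :
    Y k ↔ X k := by
  by_cases hx : X k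
  · have key : ∀ i, l ≤ i → i ≤ k → X i → Y i := by
      intro i hi
      induction i, hi using Nat.le_induction with
      | base => intro _ h; rw [hY]; exact mono _ _ _ (fun _ => hx) (hX.1 h)
      | succ i hi ih =>
        intro h1 h2
        rw [hYs i hi h1]
        exact mono _ _ _ (ih (by omega)) ((hXs i hi h1).1 h2)
    exact ⟨fun _ => hx, fun _ => key k hk le_rfl hx⟩
  · have key : ∀ i, l ≤ i → i ≤ k → Y i → X i := by
      intro i hi
      induction i, hi using Nat.le_induction with
      | base => intro _ h; rw [hX]; exact mono _ _ _ (fun h => (hx h).elim) (hY.1 h)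
      | succ i hi ih =>
        intro h1 h2
        rw [hXs i hi h1]
        exact mono _ _ _ (ih (by omega)) ((hYs i hi h1).1 h2)
    exact ⟨key k hk le_rfl, fun h => (hx h).elim⟩

/- ### Soundness in the loop case -/

theorem pV_min (v : PLTL AP → ℕ → ℕ → Prop) (f : PLTL AP) (d D i : ℕ) (h : f.delta ≤ D) :
    pV v f (min d D) i = pV v f d i := by
  unfold pV
  rw [(by omega : min (min d D) f.delta = min d f.delta)]

theorem pV_big (v : PLTL AP → ℕ → ℕ → Prop) (f : PLTL AP) (d i : ℕ) (h : f.delta ≤ d) :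
    pV v f d i = v f f.delta i := by
  unfold pV
  rw [(by omega : min d f.delta = f.delta)]

theorem last_step {k l} {lsel : ℕ → Prop} {LE : Prop} {v : PLTL AP → ℕ → ℕ → Prop}
    (hl : 1 ≤ l) (hk : l ≤ k) (hs : lsel l) {φ : PLTL AP} (h : pLastC k lsel LE v φ)
    (n : ℕ × ℕ) : pV v φ n.1 (n.2 + 1) ↔ pV v φ (sc k l n).1 (sc k l n).2 := by
  rw [sc]
  split_ifs with hn
  · simp only [hn]
    rw [pV, (h (min n.1 φ.delta) (by omega)).2 l hl hk hs, pV, pV]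
    rw [(by omega : min (min n.1 φ.delta + 1) φ.delta = min (n.1 + 1) φ.delta)]
  · rfl

/-- One-step equation for the past operators, capped variables. -/
theorem past_step {k l : ℕ} (hl : 1 ≤ l) (hk : l ≤ k) {lsel : ℕ → Prop}
    (hs : ∀ i, 1 ≤ i → i ≤ k → (lsel i ↔ i = l))
    (V : ℕ → ℕ → Prop) (F : ℕ → ℕ → Prop → Prop) (D : ℕ)
    (mono : ∀ d i (p q : Prop), (p → q) → F d i p → F d i q)
    (hF : ∀ d i p, D ≤ d → (F d i p ↔ F D i p))
    (h0 : ∀ i, 1 ≤ i → i ≤ k → (V 0 i ↔ F 0 i (V 0 (i-1))))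
    (h1 : ∀ d, 1 ≤ d → d ≤ D + 1 → ∀ i, 1 ≤ i → i ≤ k →
      (V d i ↔ F d i ((lsel i ∧ V (d-1) k) ∨ (¬ lsel i ∧ V d (i-1)))))
    (n : ℕ × ℕ) (hn : n.2 ≤ k) (hn' : n.1 = 0 ∨ l ≤ n.2) :
    V (min (sc k l n).1 (D+1)) (sc k l n).2 ↔
      F (sc k l n).1 (sc k l n).2 (V (min n.1 (D+1)) n.2) := by
  have Fcongr : ∀ d i (p q : Prop), (p ↔ q) → (F d i p ↔ F d i q) := by
    intro d i p q h; rw [h]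
  have hloop : ∀ d, 1 ≤ d → d ≤ D+1 → (V d l ↔ F d l (V (d-1) k)) := by
    intro d a b
    rw [h1 d a b l hl hk]
    apply Fcongr
    have := (hs l hl hk).2 rfl
    tauto
  have hstep : ∀ d, d ≤ D+1 → ∀ i, 1 ≤ i → i ≤ k → (i ≠ l ∨ d = 0) →
      (V d i ↔ F d i (V d (i-1))) := by
    intro d hd i a b c
    rcases Nat.eq_zero_or_pos d with h | h
    · subst h; exact h0 i a b
    · rw [h1 d h hd i a b]
      apply Fcongr
      have := (hs i a b)
      have : ¬ lsel i := by rw [this]; omega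
      tauto
  have stab : V (D+1) k ↔ V D k := by
    refine idem k l hk (F D) (mono D) (V D) (V (D+1)) (if D = 0 then V 0 (l-1) else V (D-1) k)
      ?_ ?_ ?_ ?_
    · split_ifs with hD
      · subst hD; exact h0 l hl hk
      · exact hloop D (by omega) (by omega)
    · intro i a b
      exact hstep D (by omega) (i+1) (by omega) (by omega) (by omega)
    · rw [hloop (D+1) (by omega) le_rfl, hF _ _ _ (by omega : D ≤ D+1)]; rfl
    · intro i a b
      rw [hstep (D+1) (by omega) (i+1) (by omega) (by omega) (by omega), hF _ _ _ (by omega : D ≤ D+1)]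
      rfl
  have Fmin : ∀ d i p, F (min d (D+1)) i p ↔ F d i p := by
    intro d i p
    rcases Nat.lt_or_ge d (D+1) with h | h
    · rw [Nat.min_eq_left (by omega)]
    · rw [Nat.min_eq_right h, hF _ _ _ (by omega : D ≤ d), hF _ _ _ (by omega : D ≤ D+1)]
  rw [sc]
  split_ifs with hnk
  · simp only
    rw [hloop _ (by omega) (by omega), Fmin]
    apply Fcongr
    rw [hnk]
    rcases Nat.lt_or_ge n.1 (D+1) with h | h
    · rw [(by omega : min (n.1+1) (D+1) - 1 = min n.1 (D+1))]
    · rw [(by omega : min (n.1+1) (D+1) - 1 = D), (by omega : min n.1 (D+1) = D+1), stab]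
  · simp only
    rw [hstep _ (by omega) (n.2+1) (by omega) (by omega) (by omega), Fmin]
    rfl

theorem aux_untl {k : ℕ} (a P : ℕ → Prop) (h0 : ¬ a 0)
    (h : ∀ i, 1 ≤ i → i ≤ k → (a i ↔ (a (i-1) ∨ P i))) :
    ∀ j, j ≤ k → (a j ↔ ∃ i, 1 ≤ i ∧ i ≤ j ∧ P i) := by
  intro j
  induction j with
  | zero => intro _; simp only [h0, false_iff]; rintro ⟨i, a, b, _⟩; omega
  | succ j ih =>
    intro hj
    rw [h (j+1) (by omega) hj, Nat.add_sub_cancel, ih (by omega)]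
    constructor
    · rintro (⟨i, a, b, c⟩ | c)
      · exact ⟨i, a, by omega, c⟩
      · exact ⟨j+1, by omega, le_rfl, c⟩
    · rintro ⟨i, a, b, c⟩
      rcases Nat.lt_or_ge j i with h | h
      · right; rwa [(by omega : j+1 = i)]
      · exact Or.inl ⟨i, a, h, c⟩

theorem aux_rels {k : ℕ} (a P : ℕ → Prop) (h0 : a 0)
    (h : ∀ i, 1 ≤ i → i ≤ k → (a i ↔ (a (i-1) ∧ P i))) :
    ∀ j, j ≤ k → (a j ↔ ∀ i, 1 ≤ i → i ≤ j → P i) := by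
  intro j hj
  have := aux_untl (k := k) (fun i => ¬ a i) (fun i => ¬ P i) (by simpa using h0)
    (fun i h1 h2 => by rw [h i h1 h2]; tauto) j hj
  rw [← not_iff_not, this]
  push Not
  rfl

theorem loop_sound {k l} {L : S → Set AP} {s : ℕ → S} {lsel inL LE v aux}
    (hl : 1 ≤ l) (hk : l ≤ k) (hs : ∀ i, 1 ≤ i → i ≤ k → (lsel i ↔ i = l))
    (hin : ∀ i, 1 ≤ i → i ≤ k → (inL i ↔ l ≤ i)) (hLE : LE) (φ : PLTL AP)
    (h : pevC k L s lsel inL LE v aux φ) (t : ℕ) :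
    pV v φ (hh k l t).1 (hh k l t).2 ↔ PLTL.sat L (fun t => s (hh k l t).2) φ t := by
  have hsl : lsel l := (hs l hl hk).2 rfl
  have inv := hh_inv hk
  induction φ generalizing t with
  | atom p =>
    rw [pV, PLTL.delta, Nat.min_zero, h.1 _ (inv t).1, PLTL.sat]
  | natom p =>
    rw [pV, PLTL.delta, Nat.min_zero, h.1 _ (inv t).1, PLTL.sat]
  | conj f g ihf ihg =>
    replace ihf : ∀ t, pV v f (hh k l t).1 (hh k l t).2 ↔
        PLTL.sat L (fun t => s (hh k l t).2) f t := ihf h.1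
    replace ihg : ∀ t, pV v g (hh k l t).1 (hh k l t).2 ↔
        PLTL.sat L (fun t => s (hh k l t).2) g t := ihg h.2.1
    rw [pV, h.2.2.1 _ (by omega) _ (inv t).1, pV_min _ _ _ _ _ (by simp [PLTL.delta]),
      pV_min _ _ _ _ _ (by simp [PLTL.delta]), PLTL.sat, ihf, ihg]
  | disj f g ihf ihg =>
    replace ihf : ∀ t, pV v f (hh k l t).1 (hh k l t).2 ↔
        PLTL.sat L (fun t => s (hh k l t).2) f t := ihf h.1
    replace ihg : ∀ t, pV v g (hh k l t).1 (hh k l t).2 ↔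
        PLTL.sat L (fun t => s (hh k l t).2) g t := ihg h.2.1
    rw [pV, h.2.2.1 _ (by omega) _ (inv t).1, pV_min _ _ _ _ _ (by simp [PLTL.delta]),
      pV_min _ _ _ _ _ (by simp [PLTL.delta]), PLTL.sat, ihf, ihg]
  | next f ihf =>
    replace ihf : ∀ t, pV v f (hh k l t).1 (hh k l t).2 ↔
        PLTL.sat L (fun t => s (hh k l t).2) f t := ihf h.1
    rw [pV, h.2.1 _ (by omega) _ (inv t).1, pV_min _ _ _ _ _ (by simp [PLTL.delta]),
      last_step hl hk hsl (pev_last h.1), PLTL.sat, ← ihf]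
    rfl
  | untl f g ihf ihg =>
    obtain ⟨h1, h2, h3, h4, h5, h6, h7⟩ := h
    replace ihf : ∀ t, pV v f (hh k l t).1 (hh k l t).2 ↔
        PLTL.sat L (fun t => s (hh k l t).2) f t := ihf h1
    replace ihg : ∀ t, pV v g (hh k l t).1 (hh k l t).2 ↔
        PLTL.sat L (fun t => s (hh k l t).2) g t := ihg h2
    rw [PLTL.sat]
    refine U_char _ _ (fun t => pV v (.untl f g) (hh k l t).1 (hh k l t).2) ?_ ?_ t
    · intro t
      have e : v (.untl f g) (min (hh k l t).1 (PLTL.untl f g).delta) ((hh k l t).2 + 1) ↔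
        pV v (.untl f g) (hh k l (t+1)).1 (hh k l (t+1)).2 := last_step hl hk hsl h4 _
      show pV _ _ _ _ ↔ _
      rw [pV, h3 _ (by omega) _ (inv t).1, pV_min _ _ _ _ _ (by simp [PLTL.delta]),
        pV_min _ _ _ _ _ (by simp [PLTL.delta]), ihf, ihg, e]
    · intro t hC hB
      obtain ⟨j, d, a, b, c⟩ := hh_visit hk k hk le_rfl t (PLTL.untl f g).delta
      have := hC j a
      rw [c] at this
      rw [pV_big _ _ _ _ b] at this
      obtain ⟨i, hi1, hi2, hi3, hi4⟩ := (aux_untl (k := k) _ _ h5 h6 k le_rfl).1 (h7 hLE this)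
      obtain ⟨j, d, a, b, c⟩ := hh_visit hk i ((hin i hi1 hi2).1 hi3) hi2 t g.delta
      apply hB j a
      rw [← ihg, c, pV_big _ _ _ _ b]
      exact hi4
  | rels f g ihf ihg =>
    obtain ⟨h1, h2, h3, h4, h5, h6, h7⟩ := h
    replace ihf : ∀ t, pV v f (hh k l t).1 (hh k l t).2 ↔
        PLTL.sat L (fun t => s (hh k l t).2) f t := ihf h1
    replace ihg : ∀ t, pV v g (hh k l t).1 (hh k l t).2 ↔
        PLTL.sat L (fun t => s (hh k l t).2) g t := ihg h2
    rw [PLTL.sat]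
    refine R_char _ _ (fun t => pV v (.rels f g) (hh k l t).1 (hh k l t).2) ?_ ?_ t
    · intro t
      have e : v (.rels f g) (min (hh k l t).1 (PLTL.rels f g).delta) ((hh k l t).2 + 1) ↔
        pV v (.rels f g) (hh k l (t+1)).1 (hh k l (t+1)).2 := last_step hl hk hsl h4 _
      show pV _ _ _ _ ↔ _
      rw [pV, h3 _ (by omega) _ (inv t).1, pV_min _ _ _ _ _ (by simp [PLTL.delta]),
        pV_min _ _ _ _ _ (by simp [PLTL.delta]), ihf, ihg, e]
    · intro t hC hB
      obtain ⟨j, d, a, b, c⟩ := hh_visit hk k hk le_rfl t (PLTL.rels f g).delta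
      have := hC j a
      rw [c] at this
      rw [pV_big _ _ _ _ b] at this
      apply this
      apply h7 hLE
      refine (aux_rels (k := k) _ _ h5 h6 k le_rfl).2 ?_
      intro i hi1 hi2
      by_cases hi3 : inL i
      · right
        obtain ⟨j, d, a, b, c⟩ := hh_visit hk i ((hin i hi1 hi2).1 hi3) hi2 t g.delta
        have := hB j a
        rw [← ihg, c, pV_big _ _ _ _ b] at this
        exact this
      · exact Or.inl hi3
  | prev f ihf =>
    obtain ⟨h1, h2, h3, h4, h5⟩ := h
    replace ihf : ∀ t, pV v f (hh k l t).1 (hh k l t).2 ↔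
        PLTL.sat L (fun t => s (hh k l t).2) f t := ihf h1
    cases t with
    | zero =>
      have := h2 0 (by omega)
      simp [PLTL.sat, hh, pV, this]
    | succ t =>
      rw [PLTL.sat]
      simp only [Nat.succ_pos, true_and, Nat.add_sub_cancel]
      rw [← ihf]
      obtain ⟨a, b, _⟩ := inv t
      rw [hh, sc]
      split_ifs with hc
      · simp only
        rw [pV, h4 _ (by simp [PLTL.delta]) (by omega) l hl hk]
        simp only [hsl, true_and, not_true, false_and, or_false, hc]
        rw [pV, pV, PLTL.delta]
        rw [(by omega : min (min ((hh k l t).1+1) (f.delta + 1) - 1) f.delta = min (hh k l t).1 f.delta)]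
      · simp only
        rcases Nat.eq_zero_or_pos (hh k l t).1 with h0 | h0
        · rw [h0, pV, Nat.zero_min, h3 _ (by omega) (by omega)]; rfl
        · rw [pV, h4 _ (by simp [PLTL.delta]; omega) (by omega) _ (by omega) (by omega)]
          have : ¬ lsel ((hh k l t).2 + 1) := by rw [hs _ (by omega) (by omega)]; omega
          simp only [this, false_and, false_or, not_false_iff, true_and]
          rw [pV_min _ _ _ _ _ (by simp [PLTL.delta])]; rfl
  | wprev f ihf =>
    obtain ⟨h1, h2, h3, h4, h5⟩ := h
    replace ihf : ∀ t, pV v f (hh k l t).1 (hh k l t).2 ↔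
        PLTL.sat L (fun t => s (hh k l t).2) f t := ihf h1
    cases t with
    | zero =>
      have := h2 0 (by omega)
      simp [PLTL.sat, hh, pV, this]
    | succ t =>
      rw [PLTL.sat]
      simp only [Nat.add_eq_zero_iff, one_ne_zero, and_false, false_or, Nat.add_sub_cancel]
      rw [← ihf]
      obtain ⟨a, b, _⟩ := inv t
      rw [hh, sc]
      split_ifs with hc
      · simp only
        rw [pV, h4 _ (by simp [PLTL.delta]) (by omega) l hl hk]
        simp only [hsl, true_and, not_true, false_and, or_false, hc]
        rw [pV, pV, PLTL.delta]
        rw [(by omega : min (min ((hh k l t).1+1) (f.delta + 1) - 1) f.delta = min (hh k l t).1 f.delta)]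
      · simp only
        rcases Nat.eq_zero_or_pos (hh k l t).1 with h0 | h0
        · rw [h0, pV, Nat.zero_min, h3 _ (by omega) (by omega)]; rfl
        · rw [pV, h4 _ (by simp [PLTL.delta]; omega) (by omega) _ (by omega) (by omega)]
          have : ¬ lsel ((hh k l t).2 + 1) := by rw [hs _ (by omega) (by omega)]; omega
          simp only [this, false_and, false_or, not_false_iff, true_and]
          rw [pV_min _ _ _ _ _ (by simp [PLTL.delta])]; rfl
  | since f g ihf ihg =>
    obtain ⟨h1, h2, h3, h4, h5, h6⟩ := h
    replace ihf : ∀ t, pV v f (hh k l t).1 (hh k l t).2 ↔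
        PLTL.sat L (fun t => s (hh k l t).2) f t := ihf h1
    replace ihg : ∀ t, pV v g (hh k l t).1 (hh k l t).2 ↔
        PLTL.sat L (fun t => s (hh k l t).2) g t := ihg h2
    rw [PLTL.sat]
    refine S_char _ _ (fun t => pV v (.since f g) (hh k l t).1 (hh k l t).2) ?_ ?_ t
    · show pV _ _ _ _ ↔ _
      rw [← ihg, hh, pV, h3 _ (by omega), Nat.zero_min]
    · intro t
      rw [← ihg, ← ihf]
      refine past_step hl hk hs (v (.since f g)) (fun d i p => pV v g d i ∨ (pV v f d i ∧ p))
        (max f.delta g.delta) (by intros; tauto) ?_ h4 h5 _ (inv t).1 (inv t).2.1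
      intro d i p hd
      rw [pV_big v g d i (by omega), pV_big v f d i (by omega), pV_big v g _ i (by omega),
        pV_big v f _ i (by omega)]
  | trig f g ihf ihg =>
    obtain ⟨h1, h2, h3, h4, h5, h6⟩ := h
    replace ihf : ∀ t, pV v f (hh k l t).1 (hh k l t).2 ↔
        PLTL.sat L (fun t => s (hh k l t).2) f t := ihf h1
    replace ihg : ∀ t, pV v g (hh k l t).1 (hh k l t).2 ↔
        PLTL.sat L (fun t => s (hh k l t).2) g t := ihg h2
    rw [PLTL.sat]
    refine T_char _ _ (fun t => pV v (.trig f g) (hh k l t).1 (hh k l t).2) ?_ ?_ t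
    · show pV _ _ _ _ ↔ _
      rw [← ihg, hh, pV, h3 _ (by omega), Nat.zero_min]
    · intro t
      rw [← ihg, ← ihf]
      refine past_step hl hk hs (v (.trig f g)) (fun d i p => pV v g d i ∧ (pV v f d i ∨ p))
        (max f.delta g.delta) (by intros; tauto) ?_ h4 h5 _ (inv t).1 (inv t).2.1
      intro d i p hd
      rw [pV_big v g d i (by omega), pV_big v f d i (by omega), pV_big v g _ i (by omega),
        pV_big v f _ i (by omega)]


/- ### Completeness in the loop case -/

inductive Unt {N : Type} (nx : N → N) (P Q : N → Prop) : N → Prop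
  | base (n : N) : Q n → Unt nx P Q n
  | step (n : N) : P n → Unt nx P Q (nx n) → Unt nx P Q n

inductive Snc {N : Type} (pd : N → Option N) (P Q : N → Prop) : N → Prop
  | base (n : N) : Q n → Snc pd P Q n
  | step (n m : N) : P n → pd n = some m → Snc pd P Q m → Snc pd P Q n

theorem Unt_iff {N : Type} (nx : N → N) (P Q : N → Prop) (n : N) :
    Unt nx P Q n ↔ (Q n ∨ (P n ∧ Unt nx P Q (nx n))) := by
  constructor
  · intro h
    cases h with
    | base _ h => exact Or.inl h
    | step _ h h' => exact Or.inr ⟨h, h'⟩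
  · rintro (h | ⟨h, h'⟩)
    · exact .base _ h
    · exact .step _ h h'

theorem Snc_none {N : Type} (pd : N → Option N) (P Q : N → Prop) (n : N) (hn : pd n = none) :
    Snc pd P Q n ↔ Q n := by
  constructor
  · intro h
    cases h with
    | base _ h => exact h
    | step _ m _ h _ => rw [hn] at h; cases h
  · exact .base _

theorem Snc_some {N : Type} (pd : N → Option N) (P Q : N → Prop) (n m : N)
    (hn : pd n = some m) : Snc pd P Q n ↔ (Q n ∨ (P n ∧ Snc pd P Q m)) := by
  constructor
  · intro h
    cases h with
    | base _ h => exact Or.inl h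
    | step _ m' h1 h h2 =>
      rw [hn] at h
      cases h
      exact Or.inr ⟨h1, h2⟩
  · rintro (h | ⟨h, h'⟩)
    · exact .base _ h
    · exact .step _ _ h hn h'

def pd (k l : ℕ) (n : ℕ × ℕ) : Option (ℕ × ℕ) :=
  if n.2 = 0 then none
  else if n.2 = l ∧ 0 < n.1 then some (n.1 - 1, k) else some (n.1, n.2 - 1)

def gsat (L : S → Set AP) (s : ℕ → S) (k l : ℕ) : PLTL AP → ℕ × ℕ → Prop
  | .atom p, n => p ∈ L (s n.2)
  | .natom p, n => p ∉ L (s n.2)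
  | .conj f g, n => gsat L s k l f n ∧ gsat L s k l g n
  | .disj f g, n => gsat L s k l f n ∨ gsat L s k l g n
  | .next f, n => gsat L s k l f (sc k l n)
  | .untl f g, n => Unt (sc k l) (gsat L s k l f) (gsat L s k l g) n
  | .rels f g, n => ¬ Unt (sc k l) (fun m => ¬ gsat L s k l f m) (fun m => ¬ gsat L s k l g m) n
  | .prev f, n => ∃ m, pd k l n = some m ∧ gsat L s k l f m
  | .wprev f, n => ∀ m, pd k l n = some m → gsat L s k l f m
  | .since f g, n => Snc (pd k l) (gsat L s k l f) (gsat L s k l g) n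
  | .trig f g, n => ¬ Snc (pd k l) (fun m => ¬ gsat L s k l f m) (fun m => ¬ gsat L s k l g m) n

theorem sc_shift (k l d i : ℕ) : sc k l (d+1, i) = ((sc k l (d, i)).1 + 1, (sc k l (d, i)).2) := by
  simp only [sc]; split_ifs <;> rfl

theorem unt_stab {k l : ℕ} (hk : l ≤ k) (P Q : ℕ × ℕ → Prop) (D : ℕ)
    (hP : ∀ d i, D ≤ d → i ≤ k → (P (d+1, i) ↔ P (d, i)))
    (hQ : ∀ d i, D ≤ d → i ≤ k → (Q (d+1, i) ↔ Q (d, i)))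
    (d i : ℕ) (hd : D ≤ d) (hi : i ≤ k) :
    Unt (sc k l) P Q (d+1, i) ↔ Unt (sc k l) P Q (d, i) := by
  have scD : ∀ d i, D ≤ d → i ≤ k → D ≤ (sc k l (d,i)).1 ∧ (sc k l (d,i)).2 ≤ k := by
    intro d i hd hi
    simp only [sc]
    split_ifs <;> simp only <;> omega
  constructor
  · intro h
    generalize hm : (d+1, i) = m at h
    induction h generalizing d i with
    | base n h => subst hm; exact .base _ ((hQ d i hd hi).1 h)
    | step n h _ ih =>
      subst hm
      refine .step _ ((hP d i hd hi).1 h) ?_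
      exact ih _ _ (scD d i hd hi).1 (scD d i hd hi).2 (sc_shift k l d i).symm
  · intro h
    generalize hm : (d, i) = m at h
    induction h generalizing d i with
    | base n h => subst hm; exact .base _ ((hQ d i hd hi).2 h)
    | step n h _ ih =>
      subst hm
      refine .step _ ((hP d i hd hi).2 h) ?_
      rw [sc_shift]
      exact ih _ _ (scD d i hd hi).1 (scD d i hd hi).2 rfl

theorem snc_stab {k l : ℕ} (hl : 1 ≤ l) (hk : l ≤ k) (P Q : ℕ × ℕ → Prop) (D : ℕ)
    (hP : ∀ d i, D ≤ d → i ≤ k → (P (d+1, i) ↔ P (d, i)))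
    (hQ : ∀ d i, D ≤ d → i ≤ k → (Q (d+1, i) ↔ Q (d, i)))
    (d i : ℕ) (hd : D + 1 ≤ d) (hi : i ≤ k) :
    Snc (pd k l) P Q (d+1, i) ↔ Snc (pd k l) P Q (d, i) := by
  have e0 : ∀ d, Snc (pd k l) P Q (d, 0) ↔ Q (d, 0) := fun d => Snc_none _ _ _ _ rfl
  have el : ∀ d, Snc (pd k l) P Q (d+1, l) ↔
      (Q (d+1, l) ∨ (P (d+1, l) ∧ Snc (pd k l) P Q (d, k))) := by
    intro d
    apply Snc_some
    simp only [pd]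
    rw [if_neg (by omega), if_pos ⟨trivial, by omega⟩]
    rfl
  have es : ∀ d i, (i + 1 ≠ l ∨ d = 0) → (Snc (pd k l) P Q (d, i+1) ↔
      (Q (d, i+1) ∨ (P (d, i+1) ∧ Snc (pd k l) P Q (d, i)))) := by
    intro d i h
    apply Snc_some
    simp only [pd]
    rw [if_neg (by omega), if_neg (by omega)]
    rfl
  have stab : ∀ d, D ≤ d → (Snc (pd k l) P Q (d+1, k) ↔ Snc (pd k l) P Q (d, k)) := by
    intro d hd
    refine idem k l hk (fun i p => Q (d, i) ∨ (P (d, i) ∧ p)) (by intros; tauto)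
      (fun i => Snc (pd k l) P Q (d, i)) (fun i => Snc (pd k l) P Q (d+1, i))
      (if d = 0 then Snc (pd k l) P Q (0, l-1) else Snc (pd k l) P Q (d-1, k)) ?_ ?_ ?_ ?_
    · split_ifs with h0
      · subst h0
        have := es 0 (l-1) (by omega)
        rw [(by omega : l - 1 + 1 = l)] at this
        exact this
      · have := el (d-1)
        rw [(by omega : d - 1 + 1 = d)] at this
        exact this
    · intro i a b
      exact es d i (by omega)
    · have := el d
      rw [hQ d l hd hk, hP d l hd hk] at this
      exact this
    · intro i a b
      have := es (d+1) i (by omega)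
      rw [hQ d _ hd (by omega), hP d _ hd (by omega)] at this
      exact this
  induction i with
  | zero => rw [e0, e0, hQ d 0 (by omega) (by omega)]
  | succ i ih =>
    by_cases h : i + 1 = l
    · obtain ⟨d, rfl⟩ : ∃ m, d = m + 1 := ⟨d-1, by omega⟩
      rw [h, el, el, hQ _ _ (by omega) hk, hP _ _ (by omega) hk, stab d (by omega)]
    · have ih' : Snc (pd k l) P Q (d+1, i) ↔ Snc (pd k l) P Q (d, i) := ih (by omega)
      rw [es _ _ (Or.inl h), es _ _ (Or.inl h), hQ _ _ (by omega) hi, hP _ _ (by omega) hi, ih']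

theorem gsat_stab {k l : ℕ} (hl : 1 ≤ l) (hk : l ≤ k) (L : S → Set AP) (s : ℕ → S) (φ : PLTL AP) :
    ∀ d i, φ.delta ≤ d → i ≤ k → (gsat L s k l φ (d+1, i) ↔ gsat L s k l φ (d, i)) := by
  have neg : ∀ {Q : ℕ × ℕ → Prop} {D : ℕ},
      (∀ d i, D ≤ d → i ≤ k → (Q (d+1, i) ↔ Q (d, i))) →
      (∀ d i, D ≤ d → i ≤ k → ((fun m => ¬ Q m) (d+1, i) ↔ (fun m => ¬ Q m) (d, i))) := by
    intro Q D h d i h1 h2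
    exact not_congr (h d i h1 h2)
  have pdd : ∀ d i, 1 ≤ d → i ≤ k → ((pd k l (d, i) = none ∧ pd k l (d+1, i) = none) ∨
      ∃ d' i', d ≤ d' + 1 ∧ i' ≤ k ∧ pd k l (d, i) = some (d', i') ∧
        pd k l (d+1, i) = some (d'+1, i')) := by
    intro d i hd hi
    simp only [pd]
    by_cases h0 : i = 0
    · left; simp [h0]
    · right
      by_cases h1 : i = l
      · refine ⟨d-1, k, by omega, le_rfl, ?_, ?_⟩
        · rw [if_neg h0, if_pos ⟨h1, by omega⟩]
        · rw [if_neg h0, if_pos ⟨h1, by omega⟩, (by omega : d + 1 - 1 = d - 1 + 1)]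
      · refine ⟨d, i-1, by omega, by omega, ?_, ?_⟩
        · rw [if_neg h0, if_neg (by tauto)]
        · rw [if_neg h0, if_neg (by tauto)]
  induction φ with
  | atom p => intro d i _ _; exact Iff.rfl
  | natom p => intro d i _ _; exact Iff.rfl
  | conj f g ihf ihg =>
    intro d i hd hi
    simp only [PLTL.delta] at hd
    simp only [gsat]
    rw [ihf d i (by omega) hi, ihg d i (by omega) hi]
  | disj f g ihf ihg =>
    intro d i hd hi
    simp only [PLTL.delta] at hd
    simp only [gsat]
    rw [ihf d i (by omega) hi, ihg d i (by omega) hi]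
  | next f ihf =>
    intro d i hd hi
    simp only [PLTL.delta] at hd
    simp only [gsat]
    rw [sc_shift, sc]
    split_ifs with h
    · exact ihf _ _ (by omega) hk
    · refine ihf _ _ (by omega) ?_
      simp only at h ⊢; omega
  | untl f g ihf ihg =>
    intro d i hd hi
    simp only [PLTL.delta] at hd
    exact unt_stab hk _ _ (max f.delta g.delta) (fun d i a b => ihf d i (by omega) b)
      (fun d i a b => ihg d i (by omega) b) d i hd hi
  | rels f g ihf ihg =>
    intro d i hd hi
    simp only [PLTL.delta] at hd
    exact not_congr (unt_stab hk _ _ (max f.delta g.delta)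
      (fun d i a b => neg ihf d i (by omega) b)
      (fun d i a b => neg ihg d i (by omega) b) d i hd hi)
  | prev f ihf =>
    intro d i hd hi
    simp only [PLTL.delta] at hd
    simp only [gsat]
    rcases pdd d i (by omega) hi with ⟨h1, h2⟩ | ⟨d', i', a, b, h1, h2⟩
    · simp [h1, h2]
    · simp only [h1, h2, Option.some.injEq, exists_eq_left']
      exact ihf d' i' (by omega) b
  | wprev f ihf =>
    intro d i hd hi
    simp only [PLTL.delta] at hd
    simp only [gsat]
    rcases pdd d i (by omega) hi with ⟨h1, h2⟩ | ⟨d', i', a, b, h1, h2⟩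
    · simp [h1, h2]
    · simp only [h1, h2, Option.some.injEq, forall_eq']
      exact ihf d' i' (by omega) b
  | since f g ihf ihg =>
    intro d i hd hi
    simp only [PLTL.delta] at hd
    exact snc_stab hl hk _ _ (max f.delta g.delta) (fun d i a b => ihf d i (by omega) b)
      (fun d i a b => ihg d i (by omega) b) d i hd hi
  | trig f g ihf ihg =>
    intro d i hd hi
    simp only [PLTL.delta] at hd
    exact not_congr (snc_stab hl hk _ _ (max f.delta g.delta)
      (fun d i a b => neg ihf d i (by omega) b)
      (fun d i a b => neg ihg d i (by omega) b) d i hd hi)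

theorem gsat_min {k l : ℕ} (hl : 1 ≤ l) (hk : l ≤ k) (L : S → Set AP) (s : ℕ → S) (φ : PLTL AP)
    (d i : ℕ) (hd : φ.delta ≤ d) (hi : i ≤ k) :
    gsat L s k l φ (d, i) ↔ gsat L s k l φ (φ.delta, i) := by
  induction d, hd using Nat.le_induction with
  | base => rfl
  | succ d hd ih => rw [gsat_stab hl hk L s φ d i hd hi, ih]

def node (k l d i : ℕ) : ℕ × ℕ := if i ≤ k then (d, i) else (d + 1, l)

theorem unt_visit {k l : ℕ} (hk : l ≤ k) (P Q : ℕ × ℕ → Prop) (D : ℕ) (n : ℕ × ℕ)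
    (h : Unt (sc k l) P Q n) (h1 : D ≤ n.1) (h2 : l ≤ n.2) (h3 : n.2 ≤ k) :
    ∃ d i, D ≤ d ∧ l ≤ i ∧ i ≤ k ∧ Q (d, i) := by
  induction h with
  | base n h => exact ⟨n.1, n.2, h1, h2, h3, h⟩
  | step n _ _ ih =>
    apply ih
    all_goals
      simp only [sc]
      split_ifs <;> simp only <;> omega

theorem loop_complete {k l : ℕ} (hl : 1 ≤ l) (hk : l ≤ k) (L : S → Set AP) (s : ℕ → S)
    (φ : PLTL AP) :
    pevC k L s (fun i => i = l) (fun i => l ≤ i) True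
      (fun φ d i => gsat L s k l φ (node k l d i))
      (fun φ j => match φ with
        | .untl _ g => ∃ i, 1 ≤ i ∧ i ≤ j ∧ l ≤ i ∧ gsat L s k l g (node k l g.delta i)
        | .rels _ g => ∀ i, 1 ≤ i → i ≤ j → (¬ l ≤ i ∨ gsat L s k l g (node k l g.delta i))
        | _ => False) φ := by
  have hp : ∀ (φ : PLTL AP) d i, (pV (fun φ d i => gsat L s k l φ (node k l d i)) φ d i ↔
      gsat L s k l φ (node k l d i)) := by
    intro φ d i
    simp only [pV]
    rcases Nat.lt_or_ge d φ.delta with h | h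
    · rw [Nat.min_eq_left (by omega)]
    · rw [Nat.min_eq_right h]
      simp only [node]
      split_ifs with hi
      · exact (gsat_min hl hk L s φ d i h hi).symm
      · rw [gsat_min hl hk L s φ (φ.delta + 1) l (by omega) hk,
          gsat_min hl hk L s φ (d + 1) l (by omega) hk]
  have hn : ∀ d i, i ≤ k → node k l d i = (d, i) := by
    intro d i hi; rw [node, if_pos hi]
  have hs : ∀ d i, i ≤ k → node k l d (i+1) = sc k l (d, i) := by
    intro d i hi
    rw [node, sc]
    by_cases h : i = k
    · rw [if_neg (by omega), if_pos h]
    · rw [if_pos (by omega), if_neg h]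
  have hlast : ∀ φ : PLTL AP, pLastC k (fun i => i = l) True
      (fun φ d i => gsat L s k l φ (node k l d i)) φ := by
    intro φ d hd
    refine ⟨fun h => (h trivial).elim, fun i h1 h2 h3 => ?_⟩
    rw [hp]
    have e : node k l d (k+1) = (d+1, l) := by rw [node, if_neg (by omega)]
    have e2 : node k l (d+1) i = (d+1, l) := by rw [h3]; exact hn _ _ hk
    show gsat L s k l φ (node k l d (k+1)) ↔ gsat L s k l φ (node k l (d+1) i)
    rw [e, e2]
  have pd0 : ∀ d, pd k l (d, 0) = none := fun d => rfl
  have pdl : ∀ d, 1 ≤ d → pd k l (d, l) = some (d-1, k) := by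
    intro d hd
    simp only [pd]
    rw [if_neg (by omega), if_pos ⟨trivial, by omega⟩]
  have pds : ∀ d i, 1 ≤ i → (i ≠ l ∨ d = 0) → pd k l (d, i) = some (d, i-1) := by
    intro d i hi h
    simp only [pd]
    rw [if_neg (by omega), if_neg (by omega)]
  induction φ with
  | atom p => exact ⟨fun i hi => by simp only [hn _ _ hi, gsat], hlast _⟩
  | natom p => exact ⟨fun i hi => by simp only [hn _ _ hi, gsat], hlast _⟩
  | conj f g ihf ihg =>
    exact ⟨ihf, ihg, fun d _ i hi => by simp only [hp, gsat], hlast _⟩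
  | disj f g ihf ihg =>
    exact ⟨ihf, ihg, fun d _ i hi => by simp only [hp, gsat], hlast _⟩
  | next f ihf =>
    exact ⟨ihf, fun d _ i hi => by simp only [hp, gsat, hs _ _ hi, hn _ _ hi], hlast _⟩
  | untl f g ihf ihg =>
    refine ⟨ihf, ihg, fun d _ i hi => ?_, hlast _, ?_, ?_, ?_⟩
    · simp only [hp, hs _ _ hi, hn _ _ hi]
      exact Unt_iff _ _ _ _
    · rintro ⟨i, a, b, _⟩; omega
    · intro j hj hjk
      constructor
      · rintro ⟨i, a, b, c⟩
        rcases Nat.lt_or_ge i j with h | h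
        · exact Or.inl ⟨i, a, by omega, c⟩
        · right; rwa [(by omega : j = i)]
      · rintro (⟨i, a, b, c⟩ | h)
        · exact ⟨i, a, by omega, c⟩
        · exact ⟨j, hj, le_rfl, h⟩
    · intro _ h
      rw [hn _ _ le_rfl] at h
      obtain ⟨d, i, a, b, c, e⟩ := unt_visit hk _ _ _ _ h le_rfl hk le_rfl
      refine ⟨i, by omega, c, b, ?_⟩
      rw [hn _ _ c, ← gsat_min hl hk L s g d i _ c]
      · exact e
      · simp only [PLTL.delta] at a; omega
  | rels f g ihf ihg =>
    refine ⟨ihf, ihg, fun d _ i hi => ?_, hlast _, ?_, ?_, ?_⟩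
    · simp only [hp, hs _ _ hi, hn _ _ hi, gsat]
      rw [Unt_iff]
      tauto
    · intro i a b; omega
    · intro j hj hjk
      constructor
      · intro h
        exact ⟨fun i a b => h i a (by omega), h j hj le_rfl⟩
      · rintro ⟨h, h'⟩ i a b
        rcases Nat.lt_or_ge i j with h1 | h1
        · exact h i a (by omega)
        · rwa [(by omega : i = j)]
    · intro _ h
      rw [hn _ _ le_rfl]
      intro h'
      obtain ⟨d, i, a, b, c, e⟩ := unt_visit hk _ _ _ _ h' le_rfl hk le_rfl
      apply e
      have := (h i (by omega) c).resolve_left (by omega)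
      rw [hn _ _ c, ← gsat_min hl hk L s g d i _ c] at this
      · exact this
      · simp only [PLTL.delta] at a; omega
  | prev f ihf =>
    refine ⟨ihf, fun d _ => ?_, fun i h1 h2 => ?_, fun d hd _ i h1 h2 => ?_, hlast _⟩
    · simp only [hn _ _ (Nat.zero_le k), gsat, pd0]; simp
    · simp only [hp, hn _ _ h2, hn _ (i-1) (by omega), gsat, pds 0 i h1 (Or.inr rfl),
        Option.some.injEq, exists_eq_left']
    · simp only [hp, hn _ _ h2, hn _ (i-1) (by omega), hn _ k le_rfl, gsat]
      by_cases h : i = l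
      · subst h; simp [pdl d hd]
      · simp [pds d i h1 (Or.inl h), h]
  | wprev f ihf =>
    refine ⟨ihf, fun d _ => ?_, fun i h1 h2 => ?_, fun d hd _ i h1 h2 => ?_, hlast _⟩
    · simp only [hn _ _ (Nat.zero_le k), gsat, pd0]; simp
    · simp only [hp, hn _ _ h2, hn _ (i-1) (by omega), gsat, pds 0 i h1 (Or.inr rfl),
        Option.some.injEq, forall_eq']
    · simp only [hp, hn _ _ h2, hn _ (i-1) (by omega), hn _ k le_rfl, gsat]
      by_cases h : i = l
      · subst h; simp [pdl d hd]
      · simp [pds d i h1 (Or.inl h), h]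
  | since f g ihf ihg =>
    refine ⟨ihf, ihg, fun d _ => ?_, fun i h1 h2 => ?_, fun d hd _ i h1 h2 => ?_, hlast _⟩
    · simp only [hp, hn _ _ (Nat.zero_le k), gsat]
      exact Snc_none _ _ _ _ (pd0 d)
    · simp only [hp, hn _ _ h2, hn _ (i-1) (by omega), gsat]
      exact Snc_some _ _ _ _ _ (pds 0 i h1 (Or.inr rfl))
    · simp only [hp, hn _ _ h2, hn _ (i-1) (by omega), hn _ k le_rfl, gsat]
      by_cases h : i = l
      · subst h
        simp only [true_and, not_true, false_and, or_false]
        exact Snc_some _ _ _ _ _ (pdl d hd)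
      · simp only [h, true_and, not_false_iff, false_and, false_or]
        exact Snc_some _ _ _ _ _ (pds d i h1 (Or.inl h))
  | trig f g ihf ihg =>
    refine ⟨ihf, ihg, fun d _ => ?_, fun i h1 h2 => ?_, fun d hd _ i h1 h2 => ?_, hlast _⟩
    · simp only [hp, hn _ _ (Nat.zero_le k), gsat]
      rw [Snc_none _ _ _ _ (pd0 d)]
      exact not_not
    · simp only [hp, hn _ _ h2, hn _ (i-1) (by omega), gsat]
      rw [Snc_some _ _ _ _ _ (pds 0 i h1 (Or.inr rfl))]
      tauto
    · simp only [hp, hn _ _ h2, hn _ (i-1) (by omega), hn _ k le_rfl, gsat]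
      by_cases h : i = l
      · subst h
        simp only [true_and, not_true, false_and, or_false]
        rw [Snc_some _ _ _ _ _ (pdl d hd)]
        tauto
      · simp only [h, true_and, not_false_iff, false_and, false_or]
        rw [Snc_some _ _ _ _ _ (pds d i h1 (Or.inl h))]
        tauto

theorem path_hh {k l : ℕ} {π : ℕ → S} (h : IsKLoop π k l) (t : ℕ) : π (hh k l t).2 = π t := by
  obtain ⟨hl, hk, h1, h2⟩ := h
  obtain ⟨a, b, c⟩ := hh_inv hk t
  generalize hh k l t = n at a b c
  obtain ⟨d, i⟩ := n
  simp only at a b c ⊢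
  rcases b with b | b
  · rw [c, b, zero_mul, add_zero]
  · have key : ∀ d, π (i + d * (k + 1 - l)) = π i := by
      intro d
      induction d with
      | zero => simp
      | succ d ih => rw [add_mul, one_mul, ← add_assoc, h2 _ (by omega), ih]
    rw [c, key]

theorem bsat_pev (M : Kripke S AP) (ψ : PLTL AP) (k : ℕ) (π : ℕ → S) (hπ : M.InitPath π)
    (h : PLTL.bsat M.L π k ψ) : PEvSat M ψ k := by
  have hM : ModelC M k π := by
    refine ⟨hπ.1, fun i h1 h2 => ?_⟩
    have := hπ.2 (i-1)
    rwa [(by omega : i - 1 + 1 = i)] at this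
  rcases h with ⟨l, hloop, hsat⟩ | h
  · have hl := hloop.1
    have hk := hloop.2.1
    have hc := loop_complete (by omega : 1 ≤ l) hk M.L π ψ
    refine ⟨π, _, _, True, _, _, hM, ?_, hc, ?_⟩
    · refine ⟨by omega, by omega, ?_, ?_, ?_, ?_⟩
      · intro i _ _ h; rw [h]; exact hloop.2.2.1
      · intro i h1 h2; omega
      · intro i h1 h2; omega
      · simpa using hk
    · have := loop_sound (by omega : 1 ≤ l) hk (fun i _ _ => Iff.rfl) (fun i _ _ => Iff.rfl)
        trivial ψ hc 0
      have e : (fun t => π (hh k l t).2) = π := funext (path_hh hloop)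
      rw [e] at this
      have h0 := this.2 hsat
      simpa [pV, hh] using h0
  · refine ⟨π, _, _, False, _, _, hM, ?_, nl_complete M.L π k ψ, ⟨Nat.zero_le _, h⟩⟩
    simp [LoopC]

theorem pev_sound (M : Kripke S AP) (hTot : M.Total) (ψ : PLTL AP) (k : ℕ) (h : PEvSat M ψ k) :
    ∃ π, M.InitPath π ∧ PLTL.sat M.L π ψ 0 := by
  obtain ⟨s, lsel, inL, LE, v, aux, hM, hL, hp, hv⟩ := h
  by_cases hLE : LE
  · obtain ⟨l, hl, hk, hs⟩ := loop_ex hL k le_rfl (hL.2.2.2.2.2.1 hLE)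
    have hs' : ∀ i, 1 ≤ i → i ≤ k → (lsel i ↔ i = l) := by
      intro i h1 h2
      exact ⟨fun h => loop_uniq hL i l h1 hl h2 hk h hs, fun h => h ▸ hs⟩
    have hin : ∀ i, 1 ≤ i → i ≤ k → (inL i ↔ l ≤ i) := by
      intro i h1 h2
      constructor
      · intro h
        obtain ⟨l', a, b, c⟩ := loop_ex hL i h2 h
        rw [← (hs' l' a (by omega)).1 c]; exact b
      · intro h
        exact loop_mono hL l i h h2 ((hL.2.2.2.1 l hl hk).2 (Or.inr hs))
    refine ⟨fun t => s (hh k l t).2, ⟨hM.1, fun t => ?_⟩, ?_⟩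
    · show M.T (s (hh k l t).2) (s (sc k l (hh k l t)).2)
      have := (hh_inv hk t).1
      rw [sc]
      split_ifs with h
      · rw [h, ← hL.2.2.1 l hl hk hs]
        exact hM.2 l hl hk
      · exact hM.2 ((hh k l t).2 + 1) (by omega) (by omega)
    · rw [← loop_sound hl hk hs' hin hLE ψ hp 0]
      simpa [pV, hh] using hv
  · obtain ⟨π, h1, h2⟩ := nl_path M hTot k s hM
    exact ⟨π, h1, nl_sound hLE π h2 ψ hp 0 (Nat.zero_le _) hv⟩


/- ### Small model property -/

def subs : PLTL AP → Set (PLTL AP)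
  | .atom p => {.atom p}
  | .natom p => {.natom p}
  | .conj f g => insert (.conj f g) (subs f ∪ subs g)
  | .disj f g => insert (.disj f g) (subs f ∪ subs g)
  | .next f => insert (.next f) (subs f)
  | .untl f g => insert (.untl f g) (subs f ∪ subs g)
  | .rels f g => insert (.rels f g) (subs f ∪ subs g)
  | .prev f => insert (.prev f) (subs f)
  | .wprev f => insert (.wprev f) (subs f)
  | .since f g => insert (.since f g) (subs f ∪ subs g)
  | .trig f g => insert (.trig f g) (subs f ∪ subs g)

theorem subs_self (φ : PLTL AP) : φ ∈ subs φ := by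
  cases φ <;> simp [subs]

theorem subs_fin (φ : PLTL AP) : (subs φ).Finite := by
  induction φ with
  | atom p => exact Set.finite_singleton _
  | natom p => exact Set.finite_singleton _
  | next f h => exact h.insert _
  | prev f h => exact h.insert _
  | wprev f h => exact h.insert _
  | conj f g h h' => exact (h.union h').insert _
  | disj f g h h' => exact (h.union h').insert _
  | untl f g h h' => exact (h.union h').insert _
  | rels f g h h' => exact (h.union h').insert _
  | since f g h h' => exact (h.union h').insert _
  | trig f g h h' => exact (h.union h').insert _

theorem small_transport (L : S → Set AP) (π : ℕ → S) (G0 : Set (PLTL AP)) (a b : ℕ) (hab : a < b)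
    (hτ : ∀ φ ∈ G0, (PLTL.sat L π φ a ↔ PLTL.sat L π φ b))
    (hpos : ∀ φ ∈ G0, (∃ j, a < j ∧ PLTL.sat L π φ j) → ∃ j, a < j ∧ j ≤ b ∧ PLTL.sat L π φ j)
    (hneg : ∀ φ ∈ G0, (∃ j, a < j ∧ ¬ PLTL.sat L π φ j) →
      ∃ j, a < j ∧ j ≤ b ∧ ¬ PLTL.sat L π φ j)
    (φ : PLTL AP) (hφ : subs φ ⊆ G0) :
    ∀ t, (PLTL.sat L π φ (hh b (a+1) t).2 ↔
      PLTL.sat L (fun t => π (hh b (a+1) t).2) φ t) := by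
  have key : ∀ t, ∃ j0, (hh b (a+1) (t+1)).2 = j0 + 1 ∧
      ∀ φ ∈ G0, (PLTL.sat L π φ (hh b (a+1) t).2 ↔ PLTL.sat L π φ j0) := by
    intro t
    rw [hh, sc]
    split_ifs with h
    · exact ⟨a, rfl, fun φ hφ => by rw [h, hτ φ hφ]⟩
    · exact ⟨_, rfl, fun φ hφ => Iff.rfl⟩
  have h0 : (hh b (a+1) 0).2 = 0 := rfl
  have visit : ∀ i, a < i → i ≤ b → ∀ t, ∃ j, t ≤ j ∧ (hh b (a+1) j).2 = i := by
    intro i h1 h2 t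
    obtain ⟨j, d, h3, _, h4⟩ := hh_visit (by omega : a + 1 ≤ b) i h1 h2 t 0
    exact ⟨j, h3, by rw [h4]⟩
  induction φ with
  | atom p => intro t; rfl
  | natom p => intro t; rfl
  | conj f g ihf ihg =>
    have hf : subs f ⊆ G0 := fun x hx => hφ (Or.inr (Or.inl hx))
    have hg : subs g ⊆ G0 := fun x hx => hφ (Or.inr (Or.inr hx))
    intro t
    exact and_congr (ihf hf t) (ihg hg t)
  | disj f g ihf ihg =>
    have hf : subs f ⊆ G0 := fun x hx => hφ (Or.inr (Or.inl hx))
    have hg : subs g ⊆ G0 := fun x hx => hφ (Or.inr (Or.inr hx))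
    intro t
    exact or_congr (ihf hf t) (ihg hg t)
  | next f ihf =>
    have hf : subs f ⊆ G0 := fun x hx => hφ (Or.inr hx)
    intro t
    obtain ⟨j, e, h⟩ := key t
    have h1 := h _ (hφ (subs_self _))
    have h2 := ihf hf (t+1)
    rw [e] at h2
    exact h1.trans h2
  | untl f g ihf ihg =>
    have hf : subs f ⊆ G0 := fun x hx => hφ (Or.inr (Or.inl hx))
    have hg : subs g ⊆ G0 := fun x hx => hφ (Or.inr (Or.inr hx))
    have ihf' := ihf hf
    have ihg' := ihg hg
    refine U_char _ _ (fun t => PLTL.sat L π (.untl f g) (hh b (a+1) t).2) ?_ ?_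
    · intro t
      obtain ⟨j, e, h⟩ := key t
      have h1 := h _ (hφ (subs_self _))
      have h2 := h _ (hf (subs_self _))
      have h3 := h _ (hg (subs_self _))
      have h4 := sat_untl L π f g j
      have h5 := ihf' t
      have h6 := ihg' t
      simp only [e]
      exact h1.trans (h4.trans (or_congr (h3.symm.trans h6) (and_congr (h2.symm.trans h5) Iff.rfl)))
    · intro t hC hB
      obtain ⟨j, h1, h2⟩ := visit (a+1) (by omega) (by omega) t
      have h3 := hC j h1
      simp only [h2] at h3
      obtain ⟨m, h4, h5, _⟩ := h3
      obtain ⟨m, h6, h7, h8⟩ := hpos g (hg (subs_self _)) ⟨m, h4, h5⟩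
      obtain ⟨j, h1, h2⟩ := visit m h6 h7 t
      rw [← h2] at h8
      exact hB j h1 ((ihg' j).1 h8)
  | rels f g ihf ihg =>
    have hf : subs f ⊆ G0 := fun x hx => hφ (Or.inr (Or.inl hx))
    have hg : subs g ⊆ G0 := fun x hx => hφ (Or.inr (Or.inr hx))
    have ihf' := ihf hf
    have ihg' := ihg hg
    refine R_char _ _ (fun t => PLTL.sat L π (.rels f g) (hh b (a+1) t).2) ?_ ?_
    · intro t
      obtain ⟨j, e, h⟩ := key t
      have h1 := h _ (hφ (subs_self _))
      have h2 := h _ (hf (subs_self _))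
      have h3 := h _ (hg (subs_self _))
      have h4 := sat_rels L π f g j
      have h5 := ihf' t
      have h6 := ihg' t
      simp only [e]
      exact h1.trans (h4.trans (and_congr (h3.symm.trans h6) (or_congr (h2.symm.trans h5) Iff.rfl)))
    · intro t hC hB
      obtain ⟨j, h1, h2⟩ := visit (a+1) (by omega) (by omega) t
      have h3 := hC j h1
      simp only [h2] at h3
      have h9 : ∃ m, a < m ∧ ¬ PLTL.sat L π g m := by
        by_contra hcon
        push Not at hcon
        exact h3 (fun m hm => Or.inl (hcon m hm))
      obtain ⟨m, h6, h7, h8⟩ := hneg g (hg (subs_self _)) h9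
      obtain ⟨j, h1, h2⟩ := visit m h6 h7 t
      rw [← h2] at h8
      exact h8 ((ihg' j).2 (hB j h1))
  | prev f ihf =>
    have hf : subs f ⊆ G0 := fun x hx => hφ (Or.inr hx)
    have ihf' := ihf hf
    intro t
    cases t with
    | zero => simp [PLTL.sat, h0]
    | succ t =>
      obtain ⟨j, e, h⟩ := key t
      have h2 := h _ (hf (subs_self _))
      have h5 := ihf' t
      rw [e]
      simp only [PLTL.sat, Nat.add_sub_cancel]
      rw [← h2, h5]
      simp
  | wprev f ihf =>
    have hf : subs f ⊆ G0 := fun x hx => hφ (Or.inr hx)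
    have ihf' := ihf hf
    intro t
    cases t with
    | zero => simp [PLTL.sat, h0]
    | succ t =>
      obtain ⟨j, e, h⟩ := key t
      have h2 := h _ (hf (subs_self _))
      have h5 := ihf' t
      rw [e]
      simp only [PLTL.sat, Nat.add_sub_cancel]
      rw [← h2, h5]
      simp
  | since f g ihf ihg =>
    have hf : subs f ⊆ G0 := fun x hx => hφ (Or.inr (Or.inl hx))
    have hg : subs g ⊆ G0 := fun x hx => hφ (Or.inr (Or.inr hx))
    have ihf' := ihf hf
    have ihg' := ihg hg
    refine S_char _ _ (fun t => PLTL.sat L π (.since f g) (hh b (a+1) t).2) ?_ ?_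
    · have h6 := ihg' 0
      simp only [h0] at h6 ⊢
      rw [sat_since0]
      exact h6
    · intro t
      obtain ⟨j, e, h⟩ := key t
      have h1 := h _ (hφ (subs_self _))
      have h4 := sat_since L π f g j
      have h5 := ihf' (t+1)
      have h6 := ihg' (t+1)
      rw [e] at h5 h6
      simp only [e]
      exact h4.trans (or_congr h6 (and_congr h5 h1.symm))
  | trig f g ihf ihg =>
    have hf : subs f ⊆ G0 := fun x hx => hφ (Or.inr (Or.inl hx))
    have hg : subs g ⊆ G0 := fun x hx => hφ (Or.inr (Or.inr hx))
    have ihf' := ihf hf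
    have ihg' := ihg hg
    refine T_char _ _ (fun t => PLTL.sat L π (.trig f g) (hh b (a+1) t).2) ?_ ?_
    · have h6 := ihg' 0
      simp only [h0] at h6 ⊢
      rw [sat_trig0]
      exact h6
    · intro t
      obtain ⟨j, e, h⟩ := key t
      have h1 := h _ (hφ (subs_self _))
      have h4 := sat_trig L π f g j
      have h5 := ihf' (t+1)
      have h6 := ihg' (t+1)
      rw [e] at h5 h6
      simp only [e]
      exact h4.trans (and_congr h6 (or_congr h5 h1.symm))

theorem small_model [Finite S] (M : Kripke S AP) (ψ : PLTL AP) (π : ℕ → S) (hπ : M.InitPath π)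
    (h : PLTL.sat M.L π ψ 0) : ∃ k π', M.InitPath π' ∧ PLTL.bsat M.L π' k ψ := by
  classical
  have : Finite (subs ψ) := subs_fin ψ
  let τ : ℕ → S × (subs ψ → Prop) := fun t => (π t, fun φ => PLTL.sat M.L π φ.1 t)
  obtain ⟨y, hy⟩ := Finite.exists_infinite_fiber τ
  have hy' : (τ ⁻¹' {y}).Infinite := Set.infinite_coe_iff.1 hy
  obtain ⟨a, ha, _⟩ := hy'.exists_gt 0
  have bd : ∀ P : ℕ → Prop, ∃ B, (∃ j, a < j ∧ P j) → ∃ j, a < j ∧ j ≤ B ∧ P j := by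
    intro P
    by_cases hP : ∃ j, a < j ∧ P j
    · obtain ⟨j, h1, h2⟩ := hP
      exact ⟨j, fun _ => ⟨j, h1, le_rfl, h2⟩⟩
    · exact ⟨0, fun h => (hP h).elim⟩
  choose B1 hB1 using fun φ : subs ψ => bd (fun j => PLTL.sat M.L π φ.1 j)
  choose B2 hB2 using fun φ : subs ψ => bd (fun j => ¬ PLTL.sat M.L π φ.1 j)
  obtain ⟨C1, hC1⟩ := (Set.finite_range B1).bddAbove
  obtain ⟨C2, hC2⟩ := (Set.finite_range B2).bddAbove
  obtain ⟨b, hb, hab⟩ := hy'.exists_gt (a + C1 + C2)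
  have hab' : τ a = τ b := (show τ a = y from ha).trans (show τ b = y from hb).symm
  have e1 : π a = π b := congrArg Prod.fst hab'
  have e2 : ∀ φ ∈ subs ψ, (PLTL.sat M.L π φ a ↔ PLTL.sat M.L π φ b) := by
    intro φ hφ
    exact iff_of_eq (congrFun (congrArg Prod.snd hab') ⟨φ, hφ⟩)
  have hk : a + 1 ≤ b := by omega
  have tr := small_transport M.L π (subs ψ) a b (by omega) e2
    (fun φ hφ hex => by
      obtain ⟨j, h1, h2, h3⟩ := hB1 ⟨φ, hφ⟩ hex
      have := hC1 ⟨⟨φ, hφ⟩, rfl⟩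
      exact ⟨j, h1, by omega, h3⟩)
    (fun φ hφ hex => by
      obtain ⟨j, h1, h2, h3⟩ := hB2 ⟨φ, hφ⟩ hex
      have := hC2 ⟨⟨φ, hφ⟩, rfl⟩
      exact ⟨j, h1, by omega, h3⟩) ψ subset_rfl
  refine ⟨b, fun t => π (hh b (a+1) t).2, ⟨hπ.1, fun t => ?_⟩, Or.inl ⟨a+1, ⟨by omega, hk, ?_, ?_⟩,
    (tr 0).1 h⟩⟩
  · simp only [hh, sc]
    split_ifs with hc
    · rw [hc, ← e1]; exact hπ.2 a
    · exact hπ.2 _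
  · show π (hh b (a+1) a).2 = π (hh b (a+1) b).2
    rw [hh_small a (by omega), hh_small b le_rfl]
    exact e1
  · intro i hi
    obtain ⟨c1, c2, c3⟩ := hh_inv hk i
    generalize hn : hh b (a+1) i = n at c1 c2 c3
    obtain ⟨d, m⟩ := n
    simp only at c1 c2 c3
    have hm : a + 1 ≤ m := by
      rcases c2 with c2 | c2
      · rw [c2, zero_mul] at c3; omega
      · exact c2
    have := hh_loop hk (d+1) m hm c1
    show π (hh b (a+1) (i + (b + 1 - (a+1)))).2 = π (hh b (a+1) i).2
    rw [hn, c3, add_assoc, ← Nat.succ_mul, this]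

end Helpers
end BMC
open BMC in
/-- Theorem (incremental PLTL eventuality encoding): `M` has an initialised
path satisfying `ψ` iff the incremental PLTL eventuality encoding is
satisfiable for some bound `k`; in particular `π ⊨_k ψ` for an initialised
path `π` implies the encoding at `k` is satisfiable.  Equivalently, the
incremental encoding is satisfiable for a bound `k` iff the
(non-incremental) PLTL eventuality encoding is. -/
theorem incremental_pltl_encoding_correct {S AP : Type} [Finite S]
    (M : Kripke S AP) (hTot : M.Total) (ψ : PLTL AP) :
    ((∃ π : ℕ → S, M.InitPath π ∧ PLTL.sat M.L π ψ 0) ↔ ∃ k : ℕ, IncSat M ψ k) ∧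
    (∀ (k : ℕ) (π : ℕ → S), M.InitPath π → PLTL.bsat M.L π k ψ → IncSat M ψ k) ∧
    (∀ k : ℕ, IncSat M ψ k ↔ PEvSat M ψ k) := by
  refine ⟨⟨?_, ?_⟩, ?_, fun k => inc_iff_pev M ψ k⟩
  · rintro ⟨π, hπ, h⟩
    obtain ⟨k, π', hπ', h'⟩ := small_model M ψ π hπ h
    exact ⟨k, (inc_iff_pev M ψ k).2 (bsat_pev M ψ k π' hπ' h')⟩
  · rintro ⟨k, h⟩
    exact pev_sound M hTot ψ k ((inc_iff_pev M ψ k).1 h)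
  · intro k π hπ h
    exact (inc_iff_pev M ψ k).2 (bsat_pev M ψ k π hπ h)
end
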